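/- arXiv:2101.01146 — 6 statements merged into one kernel-verified Lean document; each statement's English description precedes it below -/
import Mathlib

section
/- Let (X, d_X) be a finite metric space, let μ be a (≥1)-measure on X, and let k ≥ 1 be an integer. Then there exist a finite ultrametric space (U, d_U) and a clan embedding (f, χ) of (X, d_X) into (U, d_U) with multiplicative distortion 16k such that Σ_{x∈X} μ(x)·|f(x)| ≤ μ(X)^{1+1/k}. -/
/-- A metric space satisfies the strong (ultrametric) triangle inequality. -/
def IsUltrametricSpace (U : Type*) [iU : MetricSpace U] : Prop :=
  ∀ x y z : U, dist x z ≤ max (dist x y) (dist y z)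

/-- A dominating one-to-many embedding: each point has a nonempty clan, clans are
pairwise disjoint, and distances between copies dominate the original distances. -/
def IsDominatingOneToMany (X Y : Type*) [iX : MetricSpace X] [iY : MetricSpace Y]
    (f : X → Finset Y) : Prop :=
  (∀ x, (f x).Nonempty) ∧
  (∀ x y : X, x ≠ y → Disjoint (f x) (f y)) ∧
  (∀ x y : X, x ≠ y → ∀ x' ∈ f x, ∀ y' ∈ f y, dist x y ≤ dist x' y')

/-- A clan embedding `(f, χ)` with multiplicative distortion `t`. -/
def IsClanEmbedding (X Y : Type*) [iX : MetricSpace X] [iY : MetricSpace Y]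
    (f : X → Finset Y) (χ : X → Y) (t : ℝ) : Prop :=
  IsDominatingOneToMany X Y f ∧
  (∀ x, χ x ∈ f x) ∧
  (∀ x y : X, ∃ y' ∈ f y, dist y' (χ x) ≤ t * dist x y)

lemma clan_pigeonhole (g : ℕ → ℝ) (hg : ∀ i, 0 < g i) (k : ℕ) (hk : 1 ≤ k) :
    ∃ i < k, g (i+1) * g 0 ^ (1 / (k:ℝ)) ≤ g i * g k ^ (1 / (k:ℝ)) := by
  by_contra! h
  have hk0 : k ≠ 0 := by omega
  set a := g 0 ^ (1 / (k:ℝ)) with ha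
  set b := g k ^ (1 / (k:ℝ)) with hb
  have ha0 : 0 < a := Real.rpow_pos_of_pos (hg 0) _
  have hb0 : 0 < b := Real.rpow_pos_of_pos (hg k) _
  have key : ∀ i, i + 1 ≤ k → g 0 * b ^ (i+1) < g (i+1) * a ^ (i+1) := by
    intro i
    induction i with
    | zero => intro hi; have := h 0 (by omega); simpa using this
    | succ j ih =>
      intro hi
      have h1 := ih (by omega)
      have h2 := h (j+1) (by omega)
      calc g 0 * b ^ (j+1+1) = (g 0 * b ^ (j+1)) * b := by ring
        _ < (g (j+1) * a ^ (j+1)) * b := by gcongr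
        _ = (g (j+1) * b) * a ^ (j+1) := by ring
        _ < (g (j+1+1) * a) * a ^ (j+1) := by gcongr
        _ = _ := by ring
  have h3 := key (k-1) (by omega)
  rw [show k - 1 + 1 = k by omega] at h3
  have h4 : a ^ k = g 0 := by
    rw [ha, one_div]; exact Real.rpow_inv_natCast_pow (hg 0).le hk0
  have h5 : b ^ k = g k := by
    rw [hb, one_div]; exact Real.rpow_inv_natCast_pow (hg k).le hk0
  rw [h4, h5] at h3
  linarith [mul_comm (g 0) (g k)]

/-- Recursive data: a finite ultrametric `d` on `U` of diameter at most `D`, with owner map `p`. -/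
structure ClanData {X : Type*} [MetricSpace X] (S : Finset X) (D t : ℝ) (U : Type)
    (d : U → U → ℝ) (p : U → X) (χ : X → U) : Prop where
  self : ∀ u, d u u = 0
  symm : ∀ u v, d u v = d v u
  pos : ∀ u v, u ≠ v → 0 < d u v
  ultra : ∀ u v w, d u w ≤ max (d u v) (d v w)
  le : ∀ u v, d u v ≤ D
  mem : ∀ u, p u ∈ S
  dom : ∀ u v, dist (p u) (p v) ≤ d u v
  chief : ∀ x ∈ S, p (χ x) = x
  distort : ∀ x ∈ S, ∀ y ∈ S, ∃ u, p u = y ∧ d u (χ x) ≤ t * dist x y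

def clanSumDist {U V : Type} (D : ℝ) (d : U → U → ℝ) (e : V → V → ℝ) : U ⊕ V → U ⊕ V → ℝ
  | .inl a, .inl b => d a b
  | .inr a, .inr b => e a b
  | .inl _, .inr _ => D
  | .inr _, .inl _ => D

lemma ClanData.glue {X : Type*} [MetricSpace X] {S Y Z : Finset X} {D D₁ D₂ t : ℝ} {U V : Type}
    {d : U → U → ℝ} {p : U → X} {χ : X → U} {e : V → V → ℝ} {q : V → X} {ψ : X → V}
    (h₁ : ClanData Y D₁ t U d p χ) (h₂ : ClanData Z D₂ t V e q ψ) (hD : 0 < D)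
    (hD₁ : D₁ ≤ D) (hD₂ : D₂ ≤ D) (hS : ∀ x ∈ S, ∀ y ∈ S, dist x y ≤ D)
    (hY : Y ⊆ S) (hZ : Z ⊆ S) (P : X → Prop) [DecidablePred P]
    (hPY : ∀ x ∈ S, P x → x ∈ Y) (hPZ : ∀ x ∈ S, ¬ P x → x ∈ Z)
    (hPY' : ∀ x ∈ S, P x → ∀ y ∈ S, y ∉ Y → D ≤ t * dist x y)
    (hPZ' : ∀ x ∈ S, ¬ P x → ∀ y ∈ S, y ∉ Z → D ≤ t * dist x y) :
    ClanData S D t (U ⊕ V) (clanSumDist D d e) (Sum.elim p q)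
      (fun x => if P x then .inl (χ x) else .inr (ψ x)) where
  self := by rintro (u|u) <;> simp [clanSumDist, h₁.self, h₂.self]
  symm := by
    rintro (u|u) (v|v) <;> simp only [clanSumDist]
    · exact h₁.symm _ _
    · exact h₂.symm _ _
  pos := by
    rintro (u|u) (v|v) h <;> simp only [clanSumDist]
    · exact h₁.pos _ _ (by simpa using h)
    · exact hD
    · exact hD
    · exact h₂.pos _ _ (by simpa using h)
  ultra := by
    rintro (u|u) (v|v) (w|w) <;> simp only [clanSumDist]
    · exact h₁.ultra _ _ _
    · simp
    · simpa using (h₁.le u w).trans hD₁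
    · simp
    · simp
    · simpa using (h₂.le u w).trans hD₂
    · simp
    · exact h₂.ultra _ _ _
  le := by
    rintro (u|u) (v|v) <;> simp only [clanSumDist, le_refl]
    · exact (h₁.le _ _).trans hD₁
    · exact (h₂.le _ _).trans hD₂
  mem := by
    rintro (u|u)
    · exact hY (h₁.mem u)
    · exact hZ (h₂.mem u)
  dom := by
    rintro (u|u) (v|v) <;> simp only [clanSumDist, Sum.elim_inl, Sum.elim_inr]
    · exact h₁.dom _ _
    · exact hS _ (hY (h₁.mem u)) _ (hZ (h₂.mem v))
    · exact hS _ (hZ (h₂.mem u)) _ (hY (h₁.mem v))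
    · exact h₂.dom _ _
  chief := by
    intro x hx
    by_cases hP : P x
    · simpa [hP] using h₁.chief x (hPY x hx hP)
    · simpa [hP] using h₂.chief x (hPZ x hx hP)
  distort := by
    intro x hx y hy
    by_cases hP : P x
    · simp only [hP, if_true]
      by_cases hyY : y ∈ Y
      · obtain ⟨u, hu, hu'⟩ := h₁.distort x (hPY x hx hP) y hyY
        exact ⟨.inl u, hu, hu'⟩
      · have hyP : ¬ P y := fun h => hyY (hPY y hy h)
        exact ⟨.inr (ψ y), h₂.chief y (hPZ y hy hyP), hPY' x hx hP y hy hyY⟩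
    · simp only [hP, if_false]
      by_cases hyY : y ∈ Z
      · obtain ⟨u, hu, hu'⟩ := h₂.distort x (hPZ x hx hP) y hyY
        exact ⟨.inr u, hu, hu'⟩
      · have hyP : P y := by
          by_contra h
          exact hyY (hPZ y hy h)
        exact ⟨.inl (χ y), h₁.chief y (hPY y hy hyP), hPZ' x hx hP y hy hyY⟩

open Classical in
lemma clan_main {X : Type*} [MetricSpace X] (μ : X → ℝ) (hμ : ∀ x, 1 ≤ μ x) (k : ℕ)
    (hk : 1 ≤ k) (n : ℕ) : ∀ S : Finset X, S.card ≤ n → S.Nonempty → ∀ M : ℝ,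
    (∀ x ∈ S, ∑ y ∈ S with dist x y ≤ Metric.diam (S : Set X) / 4, μ y ≤ M) →
    ∃ (U : Type) (_ : Fintype U) (d : U → U → ℝ) (p : U → X) (χ : X → U),
      ClanData S (Metric.diam (S : Set X)) (16 * k) U d p χ ∧
      ∑ u, μ (p u) ≤ (∑ x ∈ S, μ x) * M ^ (1 / (k : ℝ)) := by
  have hμ0 : ∀ x, 0 ≤ μ x := fun x => zero_le_one.trans (hμ x)
  have hk0 : (0:ℝ) < k := by exact_mod_cast hk
  induction n with
  | zero =>
    intro S hS hne
    have := hne.card_pos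
    omega
  | succ n ih =>
  intro S hcard hne M hM
  have hbd : Bornology.IsBounded (S : Set X) := S.finite_toSet.isBounded
  set D := Metric.diam (S : Set X) with hDdef
  have hSD : ∀ x ∈ S, ∀ y ∈ S, dist x y ≤ D := fun x hx y hy =>
    Metric.dist_le_diam_of_mem hbd (by simpa using hx) (by simpa using hy)
  have hD0 : 0 ≤ D := Metric.diam_nonneg
  rcases hD0.eq_or_lt with hDz | hDpos
  · obtain ⟨a, ha⟩ := hne
    have hSa : ∀ x ∈ S, x = a := fun x hx => by
      have := hSD x hx a ha
      rw [← hDz] at this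
      exact dist_le_zero.mp this
    have hSs : S = {a} := by
      ext x; simp only [Finset.mem_singleton]
      exact ⟨hSa x, fun h => h ▸ ha⟩
    refine ⟨Unit, inferInstance, fun _ _ => 0, fun _ => a, fun _ => (), ?_, ?_⟩
    · constructor
      · simp
      · simp
      · intro u v h; exact absurd rfl h
      · simp
      · intro _ _; exact hD0
      · intro _; exact ha
      · simp
      · intro x hx; exact (hSa x hx).symm
      · intro x hx y hy
        exact ⟨(), (hSa y hy).symm, by positivity⟩
    · have h1 : 1 ≤ M := by
        refine le_trans (hμ a) (le_trans ?_ (hM a ha))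
        exact Finset.single_le_sum (f := μ) (fun i _ => hμ0 i) (by simp only [Finset.mem_filter, dist_self]; exact ⟨ha, by positivity⟩)
      have h2 : 1 ≤ M ^ (1 / (k:ℝ)) := Real.one_le_rpow h1 (by positivity)
      simp only [hSs, Finset.univ_unique, Finset.sum_const, Finset.card_singleton, one_smul,
        Finset.sum_singleton]
      nlinarith [hμ0 a]
  · -- the main step
    obtain ⟨v, hv, hvmax⟩ := Finset.exists_max_image S
      (fun x => ∑ y ∈ S with dist x y ≤ D / 8, μ y) hne
    have hballmono : ∀ (r s : ℝ), r ≤ s → ∑ y ∈ S with dist v y ≤ r, μ y ≤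
        ∑ y ∈ S with dist v y ≤ s, μ y := by
      intro r s hrs
      apply Finset.sum_le_sum_of_subset_of_nonneg
      · intro y hy
        simp only [Finset.mem_filter] at hy ⊢
        exact ⟨hy.1, hy.2.trans hrs⟩
      · intro i _ _; exact hμ0 i
    set g : ℕ → ℝ := fun i => ∑ y ∈ S with dist v y ≤ D / 8 + i * (D / (8 * k)), μ y with hgdef
    have hg : ∀ i, 0 < g i := by
      intro i
      refine lt_of_lt_of_le zero_lt_one ((hμ v).trans ?_)
      exact Finset.single_le_sum (f := μ) (fun i _ => hμ0 i)
        (by simp only [Finset.mem_filter, dist_self]; exact ⟨hv, by positivity⟩)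
    obtain ⟨i, hik, hi⟩ := clan_pigeonhole g hg k hk
    set r := D / 8 + i * (D / (8 * k)) with hr
    set δ := D / (16 * k) with hδ
    have hδ0 : 0 < δ := by positivity
    have hδt : 16 * k * δ = D := by rw [hδ]; field_simp
    have hr0 : 0 ≤ r := by positivity
    have hr2 : D / 8 + ((i+1 : ℕ):ℝ) * (D / (8 * k)) = r + 2 * δ := by
      rw [hr, hδ]; push_cast; field_simp; ring
    have hrk : D / 8 + (k:ℝ) * (D / (8 * k)) = D / 4 := by
      field_simp; ring
    have hr4 : r + 2 * δ ≤ D / 4 := by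
      rw [← hr2, ← hrk]
      have : ((i+1 : ℕ):ℝ) ≤ k := by exact_mod_cast hik
      gcongr
    have hgk : g k ≤ M := by
      simp only [hgdef, hrk]; exact hM v hv
    set Y := S.filter (fun y => dist v y ≤ r + 2 * δ) with hY
    set Z := S.filter (fun y => ¬ dist v y ≤ r) with hZ
    have hYS : Y ⊆ S := Finset.filter_subset _ _
    have hZS : Z ⊆ S := Finset.filter_subset _ _
    have hvY : v ∈ Y := by
      simp only [hY, Finset.mem_filter, dist_self]; exact ⟨hv, by positivity⟩
    have hvZ : v ∉ Z := by
      simp only [hZ, Finset.mem_filter, dist_self]; tauto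
    have hYdiam : Metric.diam (Y : Set X) ≤ D / 2 := by
      apply Metric.diam_le_of_forall_dist_le (by positivity)
      intro x hx y hy
      simp only [hY, Finset.coe_filter, Set.mem_ofPred_eq] at hx hy
      linarith [dist_triangle_left x y v, hx.2, hy.2]
    have hZdiam : Metric.diam (Z : Set X) ≤ D :=
      Metric.diam_mono (by exact_mod_cast hZS) hbd
    have hYne : Y ≠ S := by
      intro h
      rw [h, ← hDdef] at hYdiam
      linarith
    have hYc : Y.card ≤ n := by
      have := Finset.card_lt_card (hYS.ssubset_of_ne hYne)
      omega
    have hZc : Z.card ≤ n := by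
      have := Finset.card_lt_card (hZS.ssubset_of_ne (fun h => hvZ (h ▸ hv)))
      omega
    have hZn : Z.Nonempty := by
      obtain ⟨z, hz, hzY⟩ := Finset.exists_of_ssubset (hYS.ssubset_of_ne hYne)
      refine ⟨z, ?_⟩
      simp only [hY, hZ, Finset.mem_filter, not_and] at hzY ⊢
      exact ⟨hz, fun h => hzY hz (by linarith)⟩
    obtain ⟨U, iU, d, p, χ, h₁, hs₁⟩ := ih Y hYc ⟨v, hvY⟩ (g 0) (by
      intro x hx
      have : g 0 = ∑ y ∈ S with dist v y ≤ D / 8, μ y := by simp [hgdef]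
      rw [this]
      refine le_trans ?_ (hvmax x (hYS hx))
      apply Finset.sum_le_sum_of_subset_of_nonneg
      · intro y hy
        simp only [Finset.mem_filter] at hy ⊢
        exact ⟨hYS hy.1, by linarith [hy.2]⟩
      · intro i _ _; exact hμ0 i)
    obtain ⟨V, iV, e, q, ψ, h₂, hs₂⟩ := ih Z hZc hZn M (by
      intro x hx
      refine le_trans ?_ (hM x (hZS hx))
      apply Finset.sum_le_sum_of_subset_of_nonneg
      · intro y hy
        simp only [Finset.mem_filter] at hy ⊢
        exact ⟨hZS hy.1, by linarith [hy.2]⟩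
      · intro i _ _; exact hμ0 i)
    refine ⟨U ⊕ V, inferInstance, _, _, _, ClanData.glue h₁ h₂ hDpos (by linarith) hZdiam hSD
      hYS hZS (fun x => dist v x ≤ r + δ) ?_ ?_ ?_ ?_, ?_⟩
    · intro x hx hP
      simp only [hY, Finset.mem_filter]
      exact ⟨hx, by linarith⟩
    · intro x hx hP
      simp only [hZ, Finset.mem_filter]
      exact ⟨hx, by linarith⟩
    · intro x hx hP y hy hyY
      have h : r + 2 * δ < dist v y := by
        by_contra! h
        exact hyY (by simp only [hY, Finset.mem_filter]; exact ⟨hy, h⟩)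
      have : δ ≤ dist x y := by linarith [dist_triangle v x y]
      calc D = 16 * k * δ := hδt.symm
        _ ≤ _ := by gcongr
    · intro x hx hP y hy hyZ
      have h : dist v y ≤ r := by
        by_contra h
        exact hyZ (by simp only [hZ, Finset.mem_filter]; exact ⟨hy, h⟩)
      have : δ ≤ dist x y := by linarith [dist_triangle_right v x y]
      calc D = 16 * k * δ := hδt.symm
        _ ≤ _ := by gcongr
    · simp only [Fintype.sum_sum_type, Sum.elim_inl, Sum.elim_inr]
      have hY1 : ∑ x ∈ Y, μ x = g (i+1) := by
        simp only [hgdef, hr2, hY]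
      have hsplit : g i + ∑ x ∈ Z, μ x = ∑ x ∈ S, μ x := by
        simp only [hgdef, hZ, ← hr]
        exact Finset.sum_filter_add_sum_filter_not S _ μ
      rw [hY1] at hs₁
      have hle : g k ^ (1 / (k:ℝ)) ≤ M ^ (1 / (k:ℝ)) :=
        Real.rpow_le_rpow (hg k).le hgk (by positivity)
      have := mul_le_mul_of_nonneg_left hle (hg i).le
      rw [← hsplit, add_mul]
      linarith

/-- clan embedding of a finite metric space into an ultrametric with
multiplicative distortion `16 k` and weighted clan size `≤ μ(X)^{1+1/k}`. -/
theorem clan_embedding_into_ultrametric_measure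
    (X : Type*) [MetricSpace X] [Fintype X]
    (μ : X → ℝ) (hμ : ∀ x, 1 ≤ μ x) (k : ℕ) (hk : 1 ≤ k) :
    ∃ (U : Type) (_ : MetricSpace U) (_ : Fintype U)
      (f : X → Finset U) (χ : X → U),
      IsUltrametricSpace U ∧
      IsClanEmbedding X U f χ (16 * k : ℝ) ∧
      ∑ x, μ x * ((f x).card : ℝ) ≤ (∑ x, μ x) ^ (1 + 1 / (k : ℝ)) := by
  classical
  have hμ0 : ∀ x, 0 ≤ μ x := fun x => zero_le_one.trans (hμ x)
  have hk0 : (0:ℝ) < k := by exact_mod_cast hk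
  rcases isEmpty_or_nonempty X with hX | hX
  · refine ⟨Empty, inferInstance, inferInstance, fun _ => ∅, fun x => hX.elim x, ?_, ?_, ?_⟩
    · intro x; exact x.elim
    · exact ⟨⟨fun x => hX.elim x, fun x => hX.elim x, fun x => hX.elim x⟩,
        fun x => hX.elim x, fun x => hX.elim x⟩
    · simp only [Finset.univ_eq_empty, Finset.sum_empty]
      exact Real.rpow_nonneg le_rfl _
  · obtain ⟨U, iU, d, p, χ, h, hs⟩ := clan_main μ hμ k hk _ (Finset.univ : Finset X) le_rfl
      Finset.univ_nonempty (∑ x, μ x) (by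
        intro x _
        exact Finset.sum_le_sum_of_subset_of_nonneg (Finset.filter_subset _ _)
          (fun i _ _ => hμ0 i))
    let _ : MetricSpace U :=
      { dist := d
        dist_self := h.self
        dist_comm := h.symm
        dist_triangle := fun x y z => by
          have h1 : 0 ≤ d x y := dist_nonneg.trans (h.dom x y)
          have h2 : 0 ≤ d y z := dist_nonneg.trans (h.dom y z)
          exact (h.ultra x y z).trans (max_le (by linarith) (by linarith))
        eq_of_dist_eq_zero := fun {x y} hxy => by
          by_contra hne
          exact (h.pos x y hne).ne' hxy }
    refine ⟨U, inferInstance, iU, fun x => Finset.univ.filter (fun u => p u = x), χ,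
      h.ultra, ⟨⟨?_, ?_, ?_⟩, ?_, ?_⟩, ?_⟩
    · intro x
      exact ⟨χ x, by simpa using h.chief x (Finset.mem_univ x)⟩
    · intro x y hxy
      rw [Finset.disjoint_left]
      intro u hu hu2
      simp only [Finset.mem_filter, Finset.mem_univ, true_and] at hu hu2
      exact hxy (hu.symm.trans hu2)
    · intro x y _ u hu v hv
      simp only [Finset.mem_filter, Finset.mem_univ, true_and] at hu hv
      rw [← hu, ← hv]
      exact h.dom u v
    · intro x
      simpa using h.chief x (Finset.mem_univ x)
    · intro x y
      obtain ⟨u, hu, hu2⟩ := h.distort x (Finset.mem_univ x) y (Finset.mem_univ y)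
      exact ⟨u, by simpa using hu, hu2⟩
    · have hsum : ∑ x, μ x * ((Finset.univ.filter (fun u => p u = x)).card : ℝ)
          = ∑ u, μ (p u) := by
        rw [← Finset.sum_fiberwise_of_maps_to (s := (Finset.univ : Finset U))
          (t := (Finset.univ : Finset X)) (g := p) (fun _ _ => Finset.mem_univ _)]
        refine Finset.sum_congr rfl fun x _ => ?_
        rw [Finset.sum_congr rfl (g := fun _ => μ x)
          (fun u hu => by rw [(Finset.mem_filter.mp hu).2])]
        rw [Finset.sum_const, nsmul_eq_mul, mul_comm]
      have hpos : 0 < ∑ x, μ x :=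
        Finset.sum_pos (fun x _ => zero_lt_one.trans_le (hμ x)) Finset.univ_nonempty
      rw [hsum, Real.rpow_add hpos, Real.rpow_one]
      exact hs
end

section
/- Let (X, d_X) be a finite metric space with at least two points, let μ be a (≥1)-measure on X, let k ≥ 1 be an integer, and write D = diam(X). Then there exist a point v ∈ X and a radius R with 0 < R ≤ D/2 such that, setting P = B_X(v, R + D/(8k)) and Q = B_X(v, R), one has μ(P) ≤ μ(Q) · (μ*(X)/μ*(P))^{1/k}. -/
/-- The ball of radius `r` around `v`, restricted to the subset `A`. -/
noncomputable def ballIn {X : Type*} [MetricSpace X] (A : Finset X) (v : X) (r : ℝ) :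
    Finset X :=
  A.filter (fun y => dist v y ≤ r)

/-- The measure of a finite subset: `μ(A) = Σ_{x ∈ A} μ(x)`. -/
def measOf {X : Type*} (μ : X → ℝ) (A : Finset X) : ℝ := ∑ x ∈ A, μ x

/-- `μ*(A) = max_{x ∈ A} μ(B_A(x, diam(A)/4))`, expressed as a supremum. -/
noncomputable def muStar {X : Type*} [MetricSpace X] (μ : X → ℝ) (A : Finset X) : ℝ :=
  sSup ((fun x => measOf μ (ballIn A x (Metric.diam (A : Set X) / 4))) '' (A : Set X))

theorem aux_mono {X : Type*} (μ : X → ℝ) (hμ : ∀ x, 1 ≤ μ x) {A B : Finset X} (h : A ⊆ B) :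
    measOf μ A ≤ measOf μ B :=
  Finset.sum_le_sum_of_subset_of_nonneg h (fun x _ _ => zero_le_one.trans (hμ x))

theorem aux_one_le {X : Type*} (μ : X → ℝ) (hμ : ∀ x, 1 ≤ μ x) {A : Finset X} {v : X}
    (h : v ∈ A) : 1 ≤ measOf μ A :=
  (hμ v).trans (Finset.single_le_sum (fun x _ => zero_le_one.trans (hμ x)) h)

theorem aux_le_muStar {X : Type*} [MetricSpace X] (μ : X → ℝ) (A : Finset X) {x : X}
    (hx : x ∈ A) :
    measOf μ (ballIn A x (Metric.diam (A : Set X) / 4)) ≤ muStar μ A :=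
  le_csSup ((A.finite_toSet.image _).bddAbove) ⟨x, hx, rfl⟩

/-- there exist a center `v` and radius `0 < R ≤ diam(X)/2` such that
with `P = B_X(v, R + D/(8k))` and `Q = B_X(v, R)` one has
`μ(P) ≤ μ(Q) · (μ*(X)/μ*(P))^{1/k}`. -/
theorem clan_partition_claim
    (X : Type*) [MetricSpace X] [Fintype X] (hX : 2 ≤ Fintype.card X)
    (μ : X → ℝ) (hμ : ∀ x, 1 ≤ μ x) (k : ℕ) (hk : 1 ≤ k) :
    ∃ (v : X) (R : ℝ),
      0 < R ∧ R ≤ Metric.diam (Set.univ : Set X) / 2 ∧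
      ∀ P Q : Finset X,
        P = ballIn Finset.univ v (R + Metric.diam (Set.univ : Set X) / (8 * (k : ℝ))) →
        Q = ballIn Finset.univ v R →
        measOf μ P ≤ measOf μ Q * (muStar μ Finset.univ / muStar μ P) ^ (1 / (k : ℝ)) := by
  have : Nonempty X := Fintype.card_pos_iff.mp (by omega)
  have : Nontrivial X := Fintype.one_lt_card_iff_nontrivial.mp (by omega)
  set D := Metric.diam (Set.univ : Set X) with hD
  have hDpos : 0 < D := Metric.diam_pos Set.nontrivial_univ (Set.toFinite _).isBounded
  have hkpos : (0 : ℝ) < k := by exact_mod_cast hk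
  obtain ⟨v, -, hv⟩ := Finset.exists_max_image Finset.univ
    (fun x : X => measOf μ (ballIn Finset.univ x (D / 8))) Finset.univ_nonempty
  set R : ℕ → ℝ := fun i => D / 8 + i * (D / (8 * k)) with hR
  set a : ℕ → ℝ := fun i => measOf μ (ballIn Finset.univ v (R i)) with ha
  have hstep : 0 < D / (8 * (k : ℝ)) := by positivity
  have hRpos : ∀ i, 0 < R i := fun i => by simp only [hR]; positivity
  have hRk : R k = D / 4 := by simp only [hR]; field_simp; norm_num
  have hRs : ∀ i, R i + D / (8 * (k : ℝ)) = R (i + 1) := fun i => by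
    simp only [hR]; push_cast; ring
  have hRm : ∀ i, i ≤ k → R i ≤ D / 4 := fun i hi => by
    rw [← hRk]; simp only [hR]; gcongr
  have ha1 : ∀ i, 1 ≤ a i := fun i => aux_one_le μ hμ (v := v) (by
    simp [ballIn, (hRpos i).le])
  have hak : a k ≤ muStar μ Finset.univ := by
    have := aux_le_muStar μ Finset.univ (Finset.mem_univ v)
    rw [Finset.coe_univ, ← hD, ← hRk] at this
    exact this
  have hR0 : R 0 = D / 8 := by simp [hR]
  set M := muStar μ (Finset.univ : Finset X) with hM
  have ha0 : 0 < a 0 := zero_lt_one.trans_le (ha1 0)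
  have hMpos : 0 < M := (zero_lt_one.trans_le (ha1 k)).trans_le hak
  set t := (M / a 0) ^ (1 / (k : ℝ)) with ht
  have htpos : 0 < t := by positivity
  have htk : t ^ k = M / a 0 := by
    rw [ht, ← Real.rpow_natCast, ← Real.rpow_mul (by positivity), one_div,
      inv_mul_cancel₀ hkpos.ne', Real.rpow_one]
  obtain ⟨i, hik, hi⟩ : ∃ i, i < k ∧ a (i + 1) ≤ a i * t := by
    by_contra! hcon
    have key : ∀ i, i < k → a 0 * t ^ (i + 1) < a (i + 1) := by
      intro i
      induction i with
      | zero => intro h; simpa using hcon 0 h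
      | succ n ih =>
        intro h
        have h1 := ih (by omega)
        have h2 := hcon (n + 1) h
        calc a 0 * t ^ (n + 1 + 1) = (a 0 * t ^ (n + 1)) * t := by ring
          _ < a (n + 1) * t := by gcongr
          _ < _ := h2
    have := key (k - 1) (by omega)
    rw [Nat.sub_add_cancel hk, htk, mul_div_cancel₀ _ ha0.ne'] at this
    exact absurd hak (not_le.mpr this)
  refine ⟨v, R i, hRpos i, (hRm i hik.le).trans (by linarith), ?_⟩
  intro P Q hP hQ
  rw [hRs] at hP
  have hvP : v ∈ P := by rw [hP]; simp [ballIn, (hRpos (i + 1)).le]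
  have hdiam : Metric.diam (P : Set X) ≤ D / 2 := by
    refine Metric.diam_le_of_forall_dist_le (by positivity) ?_
    intro x hx y hy
    have hm := hRm (i + 1) hik
    rw [hP] at hx hy
    simp [ballIn] at hx hy
    have := dist_triangle_left x y v
    linarith
  have hPpos : 0 < muStar μ P := by
    refine zero_lt_one.trans_le (le_trans ?_ (aux_le_muStar μ P hvP))
    refine aux_one_le μ hμ (v := v) ?_
    simp only [ballIn, Finset.mem_filter, dist_self]
    exact ⟨hvP, div_nonneg Metric.diam_nonneg (by norm_num)⟩
  have hPle : muStar μ P ≤ a 0 := by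
    refine csSup_le (Set.Nonempty.image _ ⟨v, hvP⟩) ?_
    rintro _ ⟨x, -, rfl⟩
    have h1 := hv x (Finset.mem_univ x)
    simp only [ha, hR0]
    refine le_trans (aux_mono μ hμ ?_) h1
    intro y hy
    simp only [ballIn, Finset.mem_filter] at hy ⊢
    exact ⟨Finset.mem_univ y, by linarith [hy.2]⟩
  have hfin : t ≤ (M / muStar μ P) ^ (1 / (k : ℝ)) := by
    rw [ht]; gcongr
  subst hP hQ
  exact hi.trans (mul_le_mul_of_nonneg_left hfin (zero_le_one.trans (ha1 i)))
end

section
/- Let (X, d_X) be a metric space on n ≥ 1 points, let μ be a probability measure on X, and let ε ∈ (0,1]. Then there exist a finite ultrametric space (U, d_U) and a clan embedding (f, χ) of (X, d_X) into (U, d_U) with multiplicative distortion at most 16·⌈ln(2n)/ln(1+ε/2)⌉ such that E_{x∼μ}[|f(x)|] ≤ 1 + ε. -/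
/-- The inductive property: a weighted clan embedding of the subset `S`. -/
def ClanSpec {X : Type*} [MetricSpace X] [Fintype X] (w : X → ℝ) (S : Finset X)
    (t B : ℝ) : Prop :=
  ∃ (U : Type) (_ : Fintype U) (d : U → U → ℝ) (f : X → Finset U) (χ : X → U),
    (∀ a, d a a = 0) ∧ (∀ a b, d a b = d b a) ∧ (∀ a b, d a b = 0 → a = b) ∧
    (∀ a b c, d a c ≤ max (d a b) (d b c)) ∧
    (∀ a b, d a b ≤ Metric.diam (S : Set X)) ∧
    (∀ x, x ∉ S → f x = ∅) ∧
    (∀ x y, x ≠ y → Disjoint (f x) (f y)) ∧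
    (∀ x y, x ≠ y → ∀ a ∈ f x, ∀ b ∈ f y, dist x y ≤ d a b) ∧
    (∀ x ∈ S, χ x ∈ f x) ∧
    (∀ x ∈ S, ∀ y ∈ S, ∃ b ∈ f y, d b (χ x) ≤ t * dist x y) ∧
    ∑ x, w x * ((f x).card : ℝ) ≤ B

/-- Pigeonhole on growth rates. -/
lemma exists_small_growth (m : ℕ → ℝ) (k : ℕ) (hk : 1 ≤ k) (hm : ∀ i, 0 < m i) :
    ∃ i < k, m (i + 1) ≤ m i * (m k / m 0) ^ (1 / (k : ℝ)) := by
  by_contra! h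
  set c := (m k / m 0) ^ (1 / (k : ℝ)) with hc
  have hc0 : 0 < c := Real.rpow_pos_of_pos (div_pos (hm _) (hm _)) _
  have key : ∀ i, i < k → m 0 * c ^ (i + 1) < m (i + 1) := by
    intro i
    induction i with
    | zero => intro hi; simpa using h 0 hi
    | succ j ih =>
      intro hi
      have h1 := ih (by omega)
      have h2 := h (j + 1) hi
      have h3 : m 0 * c ^ (j + 1) * c < m (j + 1) * c := mul_lt_mul_of_pos_right h1 hc0
      calc m 0 * c ^ (j + 1 + 1) = m 0 * c ^ (j + 1) * c := by ring
        _ < _ := h3.trans h2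
  have h1 := key (k - 1) (by omega)
  rw [Nat.sub_add_cancel hk] at h1
  have hk0 : (k : ℝ) ≠ 0 := by positivity
  have h2 : c ^ k = m k / m 0 := by
    rw [hc, ← Real.rpow_natCast, ← Real.rpow_mul (div_pos (hm _) (hm _)).le,
      one_div_mul_cancel hk0, Real.rpow_one]
  rw [h2, mul_div_cancel₀ _ (hm 0).ne'] at h1
  exact lt_irrefl _ h1

/-- Distance on the disjoint union. -/
def sumDist {U V : Type} (d₁ : U → U → ℝ) (d₂ : V → V → ℝ) (D : ℝ) : U ⊕ V → U ⊕ V → ℝ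
  | .inl a, .inl b => d₁ a b
  | .inr a, .inr b => d₂ a b
  | .inl _, .inr _ => D
  | .inr _, .inl _ => D

open Classical in
/-- Gluing two embeddings along a cover of `S` by `P` and `Q`. -/
lemma ClanSpec.glue {X : Type*} [MetricSpace X] [Fintype X] {w : X → ℝ} {S P Q : Finset X}
    {t B₁ B₂ B : ℝ} (hP : P ⊆ S) (hQ : Q ⊆ S) (hD : 0 < Metric.diam (S : Set X))
    (R : X → Prop) (hR₁ : ∀ x ∈ S, R x → x ∈ P) (hR₂ : ∀ x ∈ S, ¬ R x → x ∈ Q)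
    (hS₁ : ∀ x ∈ S, R x → ∀ y ∈ S, y ∉ P → Metric.diam (S : Set X) ≤ t * dist x y)
    (hS₂ : ∀ x ∈ S, ¬ R x → ∀ y ∈ S, y ∉ Q → Metric.diam (S : Set X) ≤ t * dist x y)
    (hPQ : ∀ x ∈ S, x ∉ P → x ∈ Q)
    (h₁ : ClanSpec w P t B₁) (h₂ : ClanSpec w Q t B₂) (hB : B₁ + B₂ ≤ B) :
    ClanSpec w S t B := by
  obtain ⟨U, _, d, f, χ, a1, a2, a3, a4, a5, a6, a7, a8, a9, a10, a11⟩ := h₁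
  obtain ⟨V, _, e, g, ψ, b1, b2, b3, b4, b5, b6, b7, b8, b9, b10, b11⟩ := h₂
  have hbd : Bornology.IsBounded (S : Set X) := S.finite_toSet.isBounded
  have hPd : Metric.diam (P : Set X) ≤ Metric.diam (S : Set X) :=
    Metric.diam_mono (by exact_mod_cast hP) hbd
  have hQd : Metric.diam (Q : Set X) ≤ Metric.diam (S : Set X) :=
    Metric.diam_mono (by exact_mod_cast hQ) hbd
  have fS : ∀ x a, a ∈ f x → x ∈ S := fun x a ha => by
    by_contra hx
    rw [a6 x (fun h => hx (hP h))] at ha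
    simp at ha
  have gS : ∀ x a, a ∈ g x → x ∈ S := fun x a ha => by
    by_contra hx
    rw [b6 x (fun h => hx (hQ h))] at ha
    simp at ha
  refine ⟨U ⊕ V, inferInstance, sumDist d e (Metric.diam (S : Set X)),
    fun x => (f x).disjSum (g x), fun x => if R x then .inl (χ x) else .inr (ψ x),
    ?_, ?_, ?_, ?_, ?_, ?_, ?_, ?_, ?_, ?_, ?_⟩
  · rintro (a | a)
    · exact a1 a
    · exact b1 a
  · rintro (a | a) (b | b)
    · exact a2 a b
    · rfl
    · rfl
    · exact b2 a b
  · rintro (a | a) (b | b) h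
    · exact congrArg _ (a3 a b h)
    · exact absurd h hD.ne'
    · exact absurd h hD.ne'
    · exact congrArg _ (b3 a b h)
  · rintro (a | a) (b | b) (c | c)
    · exact a4 a b c
    · exact le_max_right _ _
    · exact le_max_of_le_left ((a5 a c).trans hPd)
    · exact le_max_left _ _
    · exact le_max_left _ _
    · exact le_max_of_le_left ((b5 a c).trans hQd)
    · exact le_max_right _ _
    · exact b4 a b c
  · rintro (a | a) (b | b)
    · exact (a5 a b).trans hPd
    · exact le_rfl
    · exact le_rfl
    · exact (b5 a b).trans hQd
  · intro x hx
    show (f x).disjSum (g x) = ∅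
    rw [a6 x (fun h => hx (hP h)), b6 x (fun h => hx (hQ h))]
    rfl
  · intro x y hxy
    rw [Finset.disjoint_left]
    rintro (a | a) h h'
    · rw [Finset.inl_mem_disjSum] at h h'
      exact Finset.disjoint_left.1 (a7 x y hxy) h h'
    · rw [Finset.inr_mem_disjSum] at h h'
      exact Finset.disjoint_left.1 (b7 x y hxy) h h'
  · rintro x y hxy (a | a) h (b | b) h' <;>
      simp only [Finset.inl_mem_disjSum, Finset.inr_mem_disjSum] at h h'
    · exact a8 x y hxy a h b h'
    · exact Metric.dist_le_diam_of_mem hbd (fS x a h) (gS y b h')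
    · exact Metric.dist_le_diam_of_mem hbd (gS x a h) (fS y b h')
    · exact b8 x y hxy a h b h'
  · intro x hx
    by_cases hr : R x
    · simp only [hr, if_true, Finset.inl_mem_disjSum]
      exact a9 x (hR₁ x hx hr)
    · simp only [hr, if_false, Finset.inr_mem_disjSum]
      exact b9 x (hR₂ x hx hr)
  · intro x hx y hy
    by_cases hr : R x
    · simp only [hr, if_true]
      by_cases hyP : y ∈ P
      · obtain ⟨b, hb, hb'⟩ := a10 x (hR₁ x hx hr) y hyP
        exact ⟨.inl b, Finset.inl_mem_disjSum.2 hb, hb'⟩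
      · exact ⟨.inr (ψ y), Finset.inr_mem_disjSum.2 (b9 y (hPQ y hy hyP)), hS₁ x hx hr y hy hyP⟩
    · simp only [hr, if_false]
      by_cases hyQ : y ∈ Q
      · obtain ⟨b, hb, hb'⟩ := b10 x (hR₂ x hx hr) y hyQ
        exact ⟨.inr b, Finset.inr_mem_disjSum.2 hb, hb'⟩
      · have hyP : y ∈ P := by
          by_contra h
          exact hyQ (hPQ y hy h)
        exact ⟨.inl (χ y), Finset.inl_mem_disjSum.2 (a9 y hyP), hS₂ x hx hr y hy hyQ⟩
  · refine le_trans (le_of_eq ?_) ((add_le_add a11 b11).trans hB)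
    rw [← Finset.sum_add_distrib]
    refine Finset.sum_congr rfl fun x _ => ?_
    rw [Finset.card_disjSum]
    push_cast
    ring

open Classical in
lemma clanSpec_induction {X : Type*} [MetricSpace X] [Fintype X] (w : X → ℝ)
    (hw : ∀ x, 1 ≤ w x) (k : ℕ) (hk : 1 ≤ k) (n : ℕ) :
    ∀ (S : Finset X), S.card ≤ n → S.Nonempty → ∀ M : ℝ,
      (∀ x ∈ S, ∑ y ∈ S with dist x y ≤ Metric.diam (S : Set X) / 4, w y ≤ M) →
      ClanSpec w S (16 * k) ((∑ y ∈ S, w y) * M ^ (1 / (k : ℝ))) := by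
  have hk1 : (1 : ℝ) ≤ k := by exact_mod_cast hk
  have hk0 : (0 : ℝ) < k := by linarith
  have hinv : (0 : ℝ) ≤ 1 / (k : ℝ) := by positivity
  have hw0 : ∀ x, 0 ≤ w x := fun x => zero_le_one.trans (hw x)
  induction n with
  | zero =>
    intro S hS hne
    have := hne.card_pos
    omega
  | succ n ih =>
  intro S hS hne M hM
  by_cases hsub : ∃ x, S = {x}
  · obtain ⟨x, rfl⟩ := hsub
    have hM1 : 1 ≤ M := by
      have h := hM x (by simp)
      refine (hw x).trans (le_trans (le_of_eq ?_) h)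
      rw [Finset.filter_true_of_mem (by simp)]
      simp
    refine ⟨Unit, inferInstance, fun _ _ => 0, fun y => if y = x then {()} else ∅, fun _ => (),
      by simp, by simp, by simp, by simp, by simp, ?_, ?_, ?_, by simp, by simp, ?_⟩
    · intro y hy
      simp only [Finset.mem_singleton] at hy
      simp [hy]
    · intro y z hyz
      by_cases h1 : y = x
      · have h2 : z ≠ x := fun h => hyz (h1.trans h.symm)
        simp [h2]
      · simp [h1]
    · intro y z hyz a ha b hb
      by_cases h1 : y = x
      · by_cases h2 : z = x
        · exact absurd (h1.trans h2.symm) hyz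
        · simp [h2] at hb
      · simp [h1] at ha
    · have : ∑ y, w y * (((if y = x then {()} else ∅ : Finset Unit)).card : ℝ) = w x := by
        rw [Finset.sum_eq_single x]
        · simp
        · intro b _ hb
          simp [hb]
        · simp
      rw [this, Finset.sum_singleton]
      exact le_mul_of_one_le_right (hw0 x) (Real.one_le_rpow hM1 hinv)
  have hbd : Bornology.IsBounded (S : Set X) := S.finite_toSet.isBounded
  obtain ⟨x₀, hx₀⟩ := hne
  obtain ⟨y₀, hy₀, hxy₀⟩ : ∃ y ∈ S, y ≠ x₀ := by
    by_contra! h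
    exact hsub ⟨x₀, Finset.eq_singleton_iff_unique_mem.2 ⟨hx₀, h⟩⟩
  set D := Metric.diam (S : Set X) with hDdef
  have hD : 0 < D := (dist_pos.2 hxy₀).trans_le
    (Metric.dist_le_diam_of_mem hbd hy₀ hx₀)
  set b : X → ℝ → Finset X := fun x r => S.filter (fun y => dist x y ≤ r) with hb
  have hbmem : ∀ x r y, y ∈ b x r ↔ y ∈ S ∧ dist x y ≤ r := fun x r y => Finset.mem_filter
  set W : X → ℝ → ℝ := fun x r => ∑ y ∈ b x r, w y with hW
  have hWpos : ∀ x ∈ S, ∀ r, 0 ≤ r → 0 < W x r := by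
    intro x hx r hr
    refine Finset.sum_pos (fun y _ => zero_lt_one.trans_le (hw y)) ⟨x, ?_⟩
    rw [hbmem]
    exact ⟨hx, by simpa using hr⟩
  obtain ⟨v, hv, hvmin⟩ := Finset.exists_min_image S (fun x => W x (D / 4) / W x (D / 8)) ⟨x₀, hx₀⟩
  set ρ := W v (D / 4) / W v (D / 8) with hρ
  have hρ0 : 0 < ρ := div_pos (hWpos v hv _ (by positivity)) (hWpos v hv _ (by positivity))
  set δ := D / (8 * k) with hδ
  have hδ0 : 0 < δ := by positivity
  have hkδ : k * δ = D / 8 := by rw [hδ]; field_simp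
  obtain ⟨i, hik, hi⟩ := exists_small_growth (fun i => W v (D / 8 + i * δ)) k hk
    (fun i => hWpos v hv _ (by positivity))
  simp only [Nat.cast_zero, zero_mul, add_zero] at hi
  rw [hkδ, show D / 8 + D / 8 = D / 4 by ring, ← hρ] at hi
  set r := D / 8 + i * δ with hr
  have hr0 : 0 ≤ r := by positivity
  have hr1 : D / 8 + ((i + 1 : ℕ) : ℝ) * δ = r + δ := by
    rw [hr]
    push_cast
    ring
  rw [hr1] at hi
  have hr2 : r + δ ≤ D / 4 := by
    have : ((i + 1 : ℕ) : ℝ) ≤ k := by exact_mod_cast hik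
    have := mul_le_mul_of_nonneg_right this hδ0.le
    rw [← hr1]
    linarith
  set P := b v (r + δ) with hP
  set Q := S \ b v r with hQ
  have hPS : P ⊆ S := Finset.filter_subset _ _
  have hQS : Q ⊆ S := Finset.sdiff_subset
  have hvA : v ∈ b v r := by
    rw [hbmem]
    exact ⟨hv, by simpa using hr0⟩
  have hPdiam : Metric.diam (P : Set X) ≤ D / 2 := by
    refine Metric.diam_le_of_forall_dist_le (by positivity) fun x hx y hy => ?_
    have hx' := ((hbmem _ _ _).1 (Finset.mem_coe.1 hx)).2
    have hy' := ((hbmem _ _ _).1 (Finset.mem_coe.1 hy)).2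
    have := dist_triangle_left x y v
    linarith
  have hPne : P ≠ S := by
    intro h
    rw [h] at hPdiam
    linarith
  have hPlt : P.card < S.card := Finset.card_lt_card (hPS.ssubset_of_ne hPne)
  have hQlt : Q.card < S.card := by
    refine Finset.card_lt_card (hQS.ssubset_of_ne ?_)
    intro h
    have : v ∈ Q := h ▸ hv
    exact (Finset.mem_sdiff.1 this).2 hvA
  have hbPQ : ∀ x ∈ S, x ∉ P → x ∈ Q := by
    intro x hx hxP
    refine Finset.mem_sdiff.2 ⟨hx, fun h => hxP ?_⟩
    rw [hP, hbmem]
    exact ⟨hx, by have := ((hbmem _ _ _).1 h).2; linarith⟩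
  have hPnonempty : P.Nonempty := ⟨v, by rw [hP, hbmem]; exact ⟨hv, by simp; positivity⟩⟩
  have hQnonempty : Q.Nonempty := by
    obtain ⟨x, hx, hxP⟩ := Finset.exists_of_ssubset (hPS.ssubset_of_ne hPne)
    exact ⟨x, hbPQ x hx hxP⟩
  have hM0 : 0 < M := (hWpos v hv (D / 4) (by positivity)).trans_le (hM v hv)
  have s1 := ih P (by omega) hPnonempty (M / ρ) (by
    intro u hu
    have huS := hPS hu
    have h1 : ∑ y ∈ P with dist u y ≤ Metric.diam (P : Set X) / 4, w y ≤ W u (D / 8) := by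
      refine Finset.sum_le_sum_of_subset_of_nonneg ?_ (fun y _ _ => hw0 y)
      intro y hy
      rw [Finset.mem_filter] at hy
      rw [hbmem]
      exact ⟨hPS hy.1, by linarith [hy.2]⟩
    refine h1.trans ?_
    rw [le_div_iff₀ hρ0]
    have h2 := hvmin u huS
    have h3 := hWpos u huS (D / 8) (by positivity)
    rw [le_div_iff₀ h3] at h2
    rw [mul_comm]
    exact h2.trans (hM u huS))
  have s2 := ih Q (by omega) hQnonempty M (by
    intro u hu
    refine le_trans ?_ (hM u (hQS hu))
    refine Finset.sum_le_sum_of_subset_of_nonneg ?_ (fun y _ _ => hw0 y)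
    intro y hy
    rw [Finset.mem_filter] at hy ⊢
    have : Metric.diam (Q : Set X) ≤ D := Metric.diam_mono (by exact_mod_cast hQS) hbd
    exact ⟨hQS hy.1, by linarith [hy.2]⟩)
  have hstep : ∀ x y : X, δ / 2 ≤ dist x y → D ≤ 16 * k * dist x y := by
    intro x y h
    have := mul_le_mul_of_nonneg_left h (by positivity : (0 : ℝ) ≤ 16 * k)
    linarith
  refine ClanSpec.glue hPS hQS hD (fun x => dist v x ≤ r + δ / 2) ?_ ?_ ?_ ?_ hbPQ s1 s2 ?_
  · intro x hx h
    rw [hP, hbmem]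
    exact ⟨hx, by linarith⟩
  · intro x hx h
    refine Finset.mem_sdiff.2 ⟨hx, fun h' => h ?_⟩
    have := ((hbmem _ _ _).1 h').2
    linarith
  · intro x hx h y hy hyP
    apply hstep
    by_contra! hlt
    apply hyP
    rw [hP, hbmem]
    have := dist_triangle v x y
    exact ⟨hy, by linarith⟩
  · intro x hx h y hy hyQ
    apply hstep
    by_contra! hlt
    apply hyQ
    refine Finset.mem_sdiff.2 ⟨hy, fun h' => h ?_⟩
    have h2 := ((hbmem _ _ _).1 h').2
    have := dist_triangle_right v x y
    linarith
  · have e1 : (∑ y ∈ P, w y) * (M / ρ) ^ (1 / (k : ℝ)) ≤ W v r * M ^ (1 / (k : ℝ)) := by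
      have h1 : ρ ^ (1 / (k : ℝ)) * (M / ρ) ^ (1 / (k : ℝ)) = M ^ (1 / (k : ℝ)) := by
        rw [← Real.mul_rpow hρ0.le (by positivity), mul_div_cancel₀ _ hρ0.ne']
      rw [← h1, ← mul_assoc]
      exact mul_le_mul_of_nonneg_right hi (by positivity)
    have e2 : ∑ y ∈ Q, w y + W v r = ∑ y ∈ S, w y :=
      Finset.sum_sdiff (Finset.filter_subset _ _)
    rw [← e2, add_mul]
    linarith

/-- for a probability measure `μ` on an `n`-point metric space and
`ε ∈ (0,1]`, there is a clan embedding into an ultrametric with multiplicative distortion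
`16·⌈ln(2n)/ln(1+ε/2)⌉` and expected clan size at most `1 + ε`. -/
theorem clan_embedding_into_ultrametric_probability_eps
    (X : Type*) [MetricSpace X] [Fintype X] (hn : 1 ≤ Fintype.card X)
    (μ : X → ℝ) (hμ0 : ∀ x, 0 ≤ μ x) (hμ1 : ∑ x, μ x = 1)
    (ε : ℝ) (hε0 : 0 < ε) (hε1 : ε ≤ 1) :
    ∃ (U : Type) (_ : MetricSpace U) (_ : Fintype U)
      (f : X → Finset U) (χ : X → U),
      IsUltrametricSpace U ∧
      IsClanEmbedding X U f χ
        (16 * (⌈Real.log (2 * (Fintype.card X : ℝ)) / Real.log (1 + ε / 2)⌉ : ℝ)) ∧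
      ∑ x, μ x * ((f x).card : ℝ) ≤ 1 + ε := by
  have hn1 : (1 : ℝ) ≤ (Fintype.card X : ℝ) := by exact_mod_cast hn
  set N : ℝ := (Fintype.card X : ℝ) with hN
  have hlog1 : 0 < Real.log (2 * N) := Real.log_pos (by linarith)
  have hlog2 : 0 < Real.log (1 + ε / 2) := Real.log_pos (by linarith)
  have hceil : 0 < ⌈Real.log (2 * N) / Real.log (1 + ε / 2)⌉ := Int.ceil_pos.2 (div_pos hlog1 hlog2)
  obtain ⟨k, hk⟩ := Int.eq_ofNat_of_zero_le hceil.le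
  have hle := Int.le_ceil (Real.log (2 * N) / Real.log (1 + ε / 2))
  rw [hk] at hceil hle ⊢
  have hk1 : 1 ≤ k := by omega
  have hk0 : (0 : ℝ) < k := by exact_mod_cast hk1
  simp only [Int.cast_natCast] at hle ⊢
  have hroot : (2 * N) ^ (1 / (k : ℝ)) ≤ 1 + ε / 2 := by
    rw [← Real.log_le_log_iff (by positivity) (by positivity), Real.log_rpow (by positivity)]
    rw [div_le_iff₀ hlog2] at hle
    rw [one_div, inv_mul_le_iff₀ hk0]
    exact hle
  have hw : ∀ x, 1 ≤ 1 + N * μ x := fun x => by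
    have := mul_nonneg (zero_le_one.trans hn1) (hμ0 x)
    linarith
  have htot : ∑ x, (1 + N * μ x) = 2 * N := by
    rw [Finset.sum_add_distrib, ← Finset.mul_sum, hμ1]
    simp [← hN]
    ring
  have hne : Nonempty X := Fintype.card_pos_iff.1 hn
  obtain ⟨U, hU, d, f, χ, a1, a2, a3, a4, a5, a6, a7, a8, a9, a10, a11⟩ :=
    clanSpec_induction (fun x => 1 + N * μ x) hw k hk1 _ Finset.univ le_rfl
      Finset.univ_nonempty (2 * N) (by
        intro x _
        rw [← htot]
        exact Finset.sum_le_sum_of_subset_of_nonneg (Finset.filter_subset _ _)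
          (fun y _ _ => zero_le_one.trans (hw y)))
  have hd0 : ∀ a b, 0 ≤ d a b := fun a b => by
    have := a4 a b a
    rw [a1, a2 b a, max_self] at this
    exact this
  let inst : MetricSpace U :=
    { dist := d
      dist_self := a1
      dist_comm := a2
      dist_triangle := fun a b c => (a4 a b c).trans (max_le_add_of_nonneg (hd0 _ _) (hd0 _ _))
      eq_of_dist_eq_zero := fun {a b} h => a3 a b h }
  refine ⟨U, inst, hU, f, χ, a4, ⟨⟨fun x => ⟨χ x, a9 x (Finset.mem_univ x)⟩, a7, a8⟩,
    fun x => a9 x (Finset.mem_univ x),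
    fun x y => a10 x (Finset.mem_univ x) y (Finset.mem_univ y)⟩, ?_⟩
  rw [htot] at a11
  have h1 : ∑ x, (1 + N * μ x) * ((f x).card : ℝ)
      = ∑ x, ((f x).card : ℝ) + N * ∑ x, μ x * ((f x).card : ℝ) := by
    rw [Finset.mul_sum, ← Finset.sum_add_distrib]
    exact Finset.sum_congr rfl fun x _ => by ring
  have h2 : N ≤ ∑ x, ((f x).card : ℝ) := by
    have : ∑ _x : X, (1 : ℝ) ≤ ∑ x, ((f x).card : ℝ) := by
      refine Finset.sum_le_sum fun x _ => ?_
      have : 0 < (f x).card := Finset.card_pos.2 ⟨χ x, a9 x (Finset.mem_univ x)⟩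
      exact_mod_cast this
    simpa [← hN] using this
  have h3 := mul_le_mul_of_nonneg_left hroot (by positivity : (0 : ℝ) ≤ 2 * N)
  rw [h1] at a11
  have h4 : N * ∑ x, μ x * ((f x).card : ℝ) ≤ N * (1 + ε) := by linarith
  exact le_of_mul_le_mul_left h4 (by linarith)
end

section
/- There is a universal constant C > 0 such that for every finite metric space (X, d_X) on n ≥ 2 points and every integer k ≥ 1 there exist a natural number m with 1 ≤ m ≤ C·n^{1+2/k}·log₂ n and clan embeddings (f_1,χ_1),…,(f_m,χ_m) of (X, d_X) into finite ultrametric spaces, each with multiplicative distortion 16k, such that for every x ∈ X one has (1/m)·Σ_{i=1}^m |f_i(x)| ≤ C·n^{1/k}. -/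
/-- Intermediate package: a finite labelled ultrametric for the subset `Z`, of cost at most `B`. -/
def ClanGood {X : Type} [MetricSpace X] (k : ℕ) (μ : X → ℝ) (Z : Finset X) (B : ℝ) : Prop :=
  ∃ (U : Type) (_ : Fintype U) (π : U → X) (d : U → U → ℝ) (χ : X → U),
    (∀ u, d u u = 0) ∧ (∀ u v, u ≠ v → 0 < d u v) ∧ (∀ u v, d u v = d v u) ∧
    (∀ u v w, d u w ≤ max (d u v) (d v w)) ∧
    (∀ u v, d u v ≤ Metric.diam (Z : Set X)) ∧
    (∀ u, π u ∈ Z) ∧ (∀ u v, dist (π u) (π v) ≤ d u v) ∧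
    (∀ x ∈ Z, π (χ x) = x) ∧
    (∀ x ∈ Z, ∀ y ∈ Z, ∃ u, π u = y ∧ d u (χ x) ≤ 16 * k * dist x y) ∧
    ∑ u, μ (π u) ≤ B

/-- Gluing two packages. -/
theorem clanGood_glue {X : Type} [MetricSpace X] [DecidableEq X] (k : ℕ) (μ : X → ℝ)
    (Z A Y : Finset X) (B₁ B₂ B : ℝ) (hA : A ⊆ Z) (hY : Y ⊆ Z)
    (hD : 0 < Metric.diam (Z : Set X))
    (inA : X → Prop)
    (h1 : ∀ x ∈ Z, inA x → x ∈ A ∧ ∀ y ∈ Z, y ∈ A ∨ Metric.diam (Z : Set X) ≤ 16 * k * dist x y)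
    (h2 : ∀ x ∈ Z, ¬ inA x → x ∈ Y ∧
      ∀ y ∈ Z, y ∈ Y ∨ Metric.diam (Z : Set X) ≤ 16 * k * dist x y)
    (gA : ClanGood k μ A B₁) (gY : ClanGood k μ Y B₂) (hB : B₁ + B₂ ≤ B) :
    ClanGood k μ Z B := by
  classical
  obtain ⟨U, fU, π, d, χ, a1, a2, a3, a4, a5, a6, a7, a8, a9, a10⟩ := gA
  obtain ⟨V, fV, ρ, e, ψ, b1, b2, b3, b4, b5, b6, b7, b8, b9, b10⟩ := gY
  have bd : Bornology.IsBounded (Z : Set X) := Z.finite_toSet.isBounded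
  have dA : Metric.diam (A : Set X) ≤ Metric.diam (Z : Set X) :=
    Metric.diam_mono (by exact_mod_cast hA) bd
  have dY : Metric.diam (Y : Set X) ≤ Metric.diam (Z : Set X) :=
    Metric.diam_mono (by exact_mod_cast hY) bd
  have hdist : ∀ x ∈ Z, ∀ y ∈ Z, dist x y ≤ Metric.diam (Z : Set X) := fun x hx y hy =>
    Metric.dist_le_diam_of_mem bd (by exact_mod_cast hx) (by exact_mod_cast hy)
  set D := Metric.diam (Z : Set X) with hDdef
  let d' : U ⊕ V → U ⊕ V → ℝ := fun p q => match p, q with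
    | Sum.inl u, Sum.inl v => d u v
    | Sum.inr u, Sum.inr v => e u v
    | _, _ => D
  have hd : ∀ u v, d u v ≤ D := fun u v => (a5 u v).trans dA
  have he : ∀ u v, e u v ≤ D := fun u v => (b5 u v).trans dY
  refine ⟨U ⊕ V, inferInstance, Sum.elim π ρ, d',
    fun x => if inA x then Sum.inl (χ x) else Sum.inr (ψ x), ?_, ?_, ?_, ?_, ?_, ?_, ?_, ?_, ?_, ?_⟩
  · rintro (u | u)
    · exact a1 u
    · exact b1 u
  · rintro (u | u) (v | v) h
    · exact a2 u v (fun h' => h (by rw [h']))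
    · exact hD
    · exact hD
    · exact b2 u v (fun h' => h (by rw [h']))
  · rintro (u | u) (v | v)
    · exact a3 u v
    · rfl
    · rfl
    · exact b3 u v
  · rintro (u | u) (v | v) (w | w)
    · exact a4 u v w
    · exact le_max_right _ _
    · exact (hd u w).trans (le_max_left _ _)
    · exact le_max_left _ _
    · exact le_max_left _ _
    · exact (he u w).trans (le_max_left _ _)
    · exact le_max_right _ _
    · exact b4 u v w
  · rintro (u | u) (v | v)
    · exact hd u v
    · exact le_refl _
    · exact le_refl _
    · exact he u v
  · rintro (u | u)
    · exact hA (a6 u)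
    · exact hY (b6 u)
  · rintro (u | u) (v | v)
    · exact a7 u v
    · exact hdist _ (hA (a6 u)) _ (hY (b6 v))
    · exact hdist _ (hY (b6 u)) _ (hA (a6 v))
    · exact b7 u v
  · intro x hx
    by_cases h : inA x
    · simpa [h] using a8 x (h1 x hx h).1
    · simpa [h] using b8 x (h2 x hx h).1
  · intro x hx y hy
    by_cases h : inA x
    · obtain ⟨hxA, h'⟩ := h1 x hx h
      simp only [h, if_true]
      by_cases hyA : y ∈ A
      · obtain ⟨u, hu, hu'⟩ := a9 x hxA y hyA
        exact ⟨Sum.inl u, hu, hu'⟩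
      · have hle := (h' y hy).resolve_left hyA
        have hyY : y ∈ Y := by
          by_cases hy' : inA y
          · exact absurd (h1 y hy hy').1 hyA
          · exact (h2 y hy hy').1
        exact ⟨Sum.inr (ψ y), b8 y hyY, hle⟩
    · obtain ⟨hxA, h'⟩ := h2 x hx h
      simp only [h, if_false]
      by_cases hyA : y ∈ Y
      · obtain ⟨u, hu, hu'⟩ := b9 x hxA y hyA
        exact ⟨Sum.inr u, hu, hu'⟩
      · have hle := (h' y hy).resolve_left hyA
        have hyY : y ∈ A := by
          by_cases hy' : inA y
          · exact (h1 y hy hy').1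
          · exact absurd (h2 y hy hy').1 hyA
        exact ⟨Sum.inl (χ y), a8 y hyY, hle⟩
  · rw [Fintype.sum_sum_type]
    simp only [Sum.elim_inl, Sum.elim_inr]
    linarith

/-- Pigeonhole on growth ratios. -/
theorem clan_growth (k : ℕ) (hk : 1 ≤ k) (g : ℕ → ℝ) (S : ℝ) (h0 : 0 < g 0) (hS : g k ≤ S)
    (hS0 : 0 < S) :
    ∃ i < k, g (i + 1) ≤ g i * (S / g 0) ^ (1 / (k : ℝ)) := by
  by_contra! h
  set q := (S / g 0) ^ (1 / (k : ℝ)) with hq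
  have hq0 : 0 < q := by positivity
  have hqk : q ^ k = S / g 0 := by
    rw [hq, one_div, Real.rpow_inv_natCast_pow (by positivity) (by omega)]
  have key : ∀ i, i < k → g 0 * q ^ (i + 1) < g (i + 1) := by
    intro i
    induction i with
    | zero => intro hi; simpa using h 0 hi
    | succ j ih =>
      intro hi
      have h1 := ih (by omega)
      have h2 := h (j + 1) hi
      calc g 0 * q ^ (j + 1 + 1) = (g 0 * q ^ (j + 1)) * q := by ring
        _ < g (j + 1) * q := by gcongr
        _ < _ := h2
  have := key (k - 1) (by omega)
  rw [Nat.sub_add_cancel hk, hqk] at this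
  rw [mul_div_cancel₀ _ h0.ne'] at this
  linarith

theorem clan_core {X : Type} [MetricSpace X] [DecidableEq X] (k : ℕ) (hk : 1 ≤ k) (μ : X → ℝ)
    (hμ : ∀ x, 1 ≤ μ x) : ∀ (n : ℕ) (Z : Finset X), Z.card = n → Z.Nonempty → ∀ S : ℝ,
    (∀ v ∈ Z, ∑ x ∈ Z with dist x v ≤ Metric.diam (Z : Set X) / 4, μ x ≤ S) →
    ClanGood k μ Z ((∑ x ∈ Z, μ x) * S ^ (1 / (k : ℝ))) := by
  intro n
  induction n using Nat.strong_induction_on with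
  | _ n ih =>
  intro Z hZn hZ S hS
  have hμ0 : ∀ x, 0 ≤ μ x := fun x => zero_le_one.trans (hμ x)
  have hkpos : (0 : ℝ) < k := by exact_mod_cast hk
  have hmono : ∀ P Q : Finset X, P ⊆ Q → ∑ x ∈ P, μ x ≤ ∑ x ∈ Q, μ x := fun P Q h =>
    Finset.sum_le_sum_of_subset_of_nonneg h (fun x _ _ => hμ0 x)
  have hone : ∀ P : Finset X, ∀ x ∈ P, 1 ≤ ∑ x ∈ P, μ x := fun P x hx =>
    (hμ x).trans (Finset.single_le_sum (fun y _ => hμ0 y) hx)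
  have hS1 : 1 ≤ S := by
    obtain ⟨v, hv⟩ := hZ
    refine (hone _ v ?_).trans (hS v hv)
    simp only [Finset.mem_filter, hv, dist_self, true_and]
    have := Metric.diam_nonneg (s := (Z : Set X))
    positivity
  have hSk : 1 ≤ S ^ (1 / (k : ℝ)) := Real.one_le_rpow hS1 (by positivity)
  by_cases hc : ∀ x ∈ Z, ∀ y ∈ Z, x = y
  · obtain ⟨v, hv⟩ := hZ
    refine ⟨Unit, inferInstance, fun _ => v, fun _ _ => 0, fun _ => (), by simp, by simp, by simp,
      by simp, fun _ _ => Metric.diam_nonneg, fun _ => hv, by simp, fun x hx => hc _ hv _ hx, ?_, ?_⟩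
    · intro x hx y hy
      exact ⟨(), hc _ hv _ hy, by positivity⟩
    · simp only [Finset.univ_unique, Finset.sum_singleton]
      have h1 : μ v ≤ ∑ x ∈ Z, μ x := Finset.single_le_sum (fun y _ => hμ0 y) hv
      nlinarith [hμ v]
  · push Not at hc
    obtain ⟨p, hp, q, hq, hpq⟩ := hc
    have bd : Bornology.IsBounded (Z : Set X) := Z.finite_toSet.isBounded
    have hD : 0 < Metric.diam (Z : Set X) := (dist_pos.mpr hpq).trans_le
      (Metric.dist_le_diam_of_mem bd (by exact_mod_cast hp) (by exact_mod_cast hq))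
    obtain ⟨v, hv, hmax⟩ := Finset.exists_max_image Z
      (fun v => ∑ x ∈ Z with dist x v ≤ Metric.diam (Z : Set X) / 8, μ x) hZ
    have hfar : ∃ w ∈ Z, Metric.diam (Z : Set X) / 4 < dist w v := by
      by_contra! h
      have : Metric.diam (Z : Set X) ≤ Metric.diam (Z : Set X) / 2 := by
        refine Metric.diam_le_of_forall_dist_le (by positivity) ?_
        intro x hx y hy
        have h1 := h x (by exact_mod_cast hx)
        have h2 := h y (by exact_mod_cast hy)
        have h3 := dist_triangle_right x y v
        linarith
      linarith
    obtain ⟨w, hw, hwv⟩ := hfar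
    set D := Metric.diam (Z : Set X) with hDdef
    let g : ℕ → ℝ := fun i => ∑ x ∈ Z with dist x v ≤ D / 8 + i * (D / (8 * k)), μ x
    have hg0 : g 0 = ∑ x ∈ Z with dist x v ≤ D / 8, μ x := by simp [g]
    have hg0pos : 0 < g 0 := by
      rw [hg0]
      refine zero_lt_one.trans_le (hone _ v ?_)
      simp only [Finset.mem_filter, hv, dist_self, true_and]
      positivity
    have hkD : (k : ℝ) * (D / (8 * k)) = D / 8 := by field_simp
    have hgk : g k ≤ S := by
      refine le_trans (le_of_eq ?_) (hS v hv)
      simp only [g, hkD]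
      congr 2
      ext x
      constructor <;> intro h <;> linarith
    obtain ⟨i, hi, hgi⟩ := clan_growth k hk g S hg0pos hgk (by linarith)
    set s : ℝ := D / (8 * k) with hs
    have hs0 : 0 < s := by positivity
    set r : ℝ := D / 8 + i * s with hr
    have hr8 : D / 8 ≤ r := by
      have : 0 ≤ (i : ℝ) * s := by positivity
      linarith
    have hr4 : r + s ≤ D / 4 := by
      have : ((i : ℝ) + 1) * s ≤ k * s := by
        gcongr
        exact_mod_cast hi
      linarith
    set A : Finset X := Z.filter (fun x => dist x v ≤ r + s) with hA
    set Y : Finset X := Z.filter (fun x => ¬ dist x v ≤ r) with hY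
    have hAZ : A ⊆ Z := Finset.filter_subset _ _
    have hYZ : Y ⊆ Z := Finset.filter_subset _ _
    have hvA : v ∈ A := by
      simp only [hA, Finset.mem_filter, hv, dist_self, true_and]
      linarith
    have hwY : w ∈ Y := by
      simp only [hY, Finset.mem_filter, hw, true_and]
      linarith
    have hwA : w ∉ A := by
      simp only [hA, Finset.mem_filter, hw, true_and]
      linarith
    have hvY : v ∉ Y := by
      simp only [hY, Finset.mem_filter, hv, dist_self, true_and, not_not]
      linarith
    have cA : A.card < n := hZn ▸ Finset.card_lt_card
      (Finset.ssubset_iff_subset_ne.mpr ⟨hAZ, fun h => hwA (h ▸ hw)⟩)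
    have cY : Y.card < n := hZn ▸ Finset.card_lt_card
      (Finset.ssubset_iff_subset_ne.mpr ⟨hYZ, fun h => hvY (h ▸ hv)⟩)
    have dA : Metric.diam (A : Set X) ≤ D / 2 := by
      refine Metric.diam_le_of_forall_dist_le (by positivity) ?_
      intro x hx y hy
      have h1 : dist x v ≤ r + s := (Finset.mem_filter.mp (Finset.mem_coe.mp hx)).2
      have h2 : dist y v ≤ r + s := (Finset.mem_filter.mp (Finset.mem_coe.mp hy)).2
      have h3 := dist_triangle_right x y v
      linarith
    have dY : Metric.diam (Y : Set X) ≤ D :=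
      Metric.diam_mono (by exact_mod_cast hYZ) bd
    have gA := ih A.card cA A rfl ⟨v, hvA⟩ (g 0) (by
      intro u hu
      refine le_trans ?_ (le_trans (hmax u (hAZ hu)) (le_of_eq hg0.symm))
      apply hmono
      intro x hx
      rw [Finset.mem_filter] at hx ⊢
      exact ⟨hAZ hx.1, by linarith [hx.2]⟩)
    have gY := ih Y.card cY Y rfl ⟨w, hwY⟩ S (by
      intro u hu
      refine le_trans ?_ (hS u (hYZ hu))
      apply hmono
      intro x hx
      rw [Finset.mem_filter] at hx ⊢
      exact ⟨hYZ hx.1, by linarith [hx.2]⟩)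
    have hsD : 16 * k * (s / 2) = D := by
      rw [hs]; field_simp; norm_num
    have hgA : ∑ x ∈ A, μ x = g (i + 1) := by
      simp only [g, hA]
      congr 2
      ext x
      push_cast
      rw [hr, add_mul, one_mul, add_assoc]
    have hgY : ∑ x ∈ Y, μ x = ∑ x ∈ Z, μ x - g i := by
      have := Finset.sum_filter_add_sum_filter_not Z (fun x => dist x v ≤ r) μ
      have h2 : g i = ∑ x ∈ Z with dist x v ≤ r, μ x := rfl
      rw [h2, hY]
      linarith
    refine clanGood_glue k μ Z A Y _ _ _ hAZ hYZ hD (fun x => dist x v ≤ r + s / 2) ?_ ?_ gA gY ?_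
    · intro x hx hxv
      refine ⟨Finset.mem_filter.mpr ⟨hx, by linarith⟩, fun y hy => ?_⟩
      by_cases h : dist x y < s / 2
      · left
        refine Finset.mem_filter.mpr ⟨hy, ?_⟩
        have := dist_triangle_left y v x
        linarith
      · right
        rw [← hDdef, ← hsD]
        push Not at h
        gcongr
    · intro x hx hxv
      refine ⟨Finset.mem_filter.mpr ⟨hx, by linarith⟩, fun y hy => ?_⟩
      by_cases h : dist x y < s / 2
      · left
        refine Finset.mem_filter.mpr ⟨hy, ?_⟩
        have := dist_triangle x y v
        linarith
      · right
        rw [← hDdef, ← hsD]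
        push Not at h
        gcongr
    · rw [hgA, hgY]
      have h1 : g (i + 1) * g 0 ^ (1 / (k : ℝ)) ≤ g i * S ^ (1 / (k : ℝ)) := by
        calc g (i + 1) * g 0 ^ (1 / (k : ℝ))
            ≤ g i * (S / g 0) ^ (1 / (k : ℝ)) * g 0 ^ (1 / (k : ℝ)) := by gcongr
          _ = g i * S ^ (1 / (k : ℝ)) := by
            rw [mul_assoc, ← Real.mul_rpow (by positivity) hg0pos.le,
              div_mul_cancel₀ _ hg0pos.ne']
      linarith

/-- A clan embedding into a finite ultrametric with distortion `16k`. -/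
structure ClanPack (X : Type) [MetricSpace X] (k : ℕ) where
  U : Type
  dU : MetricSpace U
  fU : Fintype U
  f : X → Finset U
  χ : X → U
  ultra : IsUltrametricSpace U (iU := dU)
  clan : IsClanEmbedding X U f χ (16 * k : ℝ) (iY := dU)

theorem clanPack_exists {X : Type} [MetricSpace X] [Fintype X] [Nonempty X] (k : ℕ) (hk : 1 ≤ k)
    (μ : X → ℝ) (hμ : ∀ x, 1 ≤ μ x) :
    ∃ P : ClanPack X k, ∑ x, μ x * ((P.f x).card : ℝ) ≤ (∑ x, μ x) * (∑ x, μ x) ^ (1 / (k : ℝ)) := by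
  classical
  obtain ⟨U, fU, π, d, χ, a1, a2, a3, a4, a5, a6, a7, a8, a9, a10⟩ :=
    clan_core k hk μ hμ _ (Finset.univ : Finset X) rfl Finset.univ_nonempty (∑ x, μ x) (by
      intro v _
      exact Finset.sum_le_sum_of_subset_of_nonneg (Finset.filter_subset _ _)
        (fun x _ _ => zero_le_one.trans (hμ x)))
  have hnn : ∀ u v, 0 ≤ d u v := fun u v => dist_nonneg.trans (a7 u v)
  let M : MetricSpace U :=
    { dist := d
      dist_self := a1
      dist_comm := a3
      dist_triangle := fun u v w => (a4 u v w).trans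
        (max_le (by linarith [hnn v w]) (by linarith [hnn u v]))
      eq_of_dist_eq_zero := by
        intro u v h
        by_contra hne
        exact (a2 u v hne).ne' h }
  refine ⟨⟨U, M, fU, fun x => Finset.univ.filter (fun u => π u = x), χ, a4, ⟨⟨?_, ?_, ?_⟩, ?_, ?_⟩⟩, ?_⟩
  · intro x
    exact ⟨χ x, by simp [a8]⟩
  · intro x y hxy
    rw [Finset.disjoint_left]
    intro u hu hv
    simp only [Finset.mem_filter, Finset.mem_univ, true_and] at hu hv
    exact hxy (hu.symm.trans hv)
  · intro x y _ u hu v hv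
    simp only [Finset.mem_filter, Finset.mem_univ, true_and] at hu hv
    subst hu hv
    exact a7 u v
  · intro x
    simp [a8]
  · intro x y
    obtain ⟨u, hu, h⟩ := a9 x (Finset.mem_univ _) y (Finset.mem_univ _)
    exact ⟨u, by simp [hu], h⟩
  · refine le_trans (le_of_eq ?_) a10
    simp only
    rw [← Finset.sum_fiberwise (Finset.univ : Finset U) π]
    refine Finset.sum_congr rfl fun x _ => ?_
    rw [Finset.sum_congr rfl (g := fun _ => μ x)]
    · rw [Finset.sum_const, nsmul_eq_mul, mul_comm]
    · intro u hu
      rw [(Finset.mem_filter.mp hu).2]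

/-- Multiplicative weights. -/
theorem clan_mwu {X : Type} [Fintype X] [Nonempty X] {ι : Type*} (c : ι → X → ℝ) (ρ α : ℝ)
    (hρ : 0 < ρ) (hα : 0 ≤ α) (h0 : ∀ i x, 0 ≤ c i x) (h1 : ∀ i x, c i x ≤ ρ)
    (hw : ∀ w : X → ℝ, (∀ x, 0 < w x) → ∃ i, ∑ x, w x * c i x ≤ α * ∑ x, w x) (T : ℕ) :
    ∃ s : Fin T → ι, ∑ x, Real.exp ((∑ t, c (s t) x) / ρ) ≤
      Fintype.card X * Real.exp (2 * α / ρ * T) := by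
  induction T with
  | zero => exact ⟨Fin.elim0, by simp⟩
  | succ T ih =>
    obtain ⟨s, hs⟩ := ih
    obtain ⟨i, hi⟩ := hw (fun x => Real.exp ((∑ t, c (s t) x) / ρ)) (fun x => Real.exp_pos _)
    refine ⟨Fin.snoc s i, ?_⟩
    simp only [Fin.sum_univ_castSucc, Fin.snoc_castSucc, Fin.snoc_last]
    set w : X → ℝ := fun x => Real.exp ((∑ t, c (s t) x) / ρ) with hwdef
    have hexp : ∀ z : ℝ, 0 ≤ z → z ≤ 1 → Real.exp z ≤ 1 + 2 * z := by
      intro z hz hz1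
      have := Real.abs_exp_sub_one_le (x := z) (by rw [abs_of_nonneg hz]; exact hz1)
      rw [abs_of_nonneg hz] at this
      linarith [le_abs_self (Real.exp z - 1)]
    calc ∑ x, Real.exp ((∑ t, c (s t) x + c i x) / ρ)
        ≤ ∑ x, (w x + 2 / ρ * (w x * c i x)) := by
          refine Finset.sum_le_sum fun x _ => ?_
          rw [add_div, Real.exp_add]
          have := hexp (c i x / ρ) (div_nonneg (h0 i x) hρ.le) ((div_le_one hρ).mpr (h1 i x))
          calc w x * Real.exp (c i x / ρ) ≤ w x * (1 + 2 * (c i x / ρ)) := by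
                gcongr
            _ = _ := by ring
      _ = ∑ x, w x + 2 / ρ * ∑ x, w x * c i x := by
          rw [Finset.sum_add_distrib, Finset.mul_sum]
      _ ≤ ∑ x, w x + 2 / ρ * (α * ∑ x, w x) := by gcongr
      _ = (∑ x, w x) * (2 * α / ρ + 1) := by ring
      _ ≤ (∑ x, w x) * Real.exp (2 * α / ρ) := by
          gcongr
          exact Real.add_one_le_exp _
      _ ≤ (Fintype.card X * Real.exp (2 * α / ρ * T)) * Real.exp (2 * α / ρ) := by gcongr
      _ = _ := by
          rw [mul_assoc, ← Real.exp_add]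
          push_cast
          ring_nf

/-- a uniform distribution over `m ≤ C·n^{1+2/k}·log₂ n` clan embeddings
into ultrametrics, each with multiplicative distortion `16k`, so that the expected clan
size of every point is at most `C·n^{1/k}`. -/
theorem uniform_distribution_clan_embeddings_k :
    ∃ C : ℝ, 0 < C ∧
      ∀ (X : Type) [MetricSpace X] [Fintype X], 2 ≤ Fintype.card X →
      ∀ k : ℕ, 1 ≤ k →
      ∃ m : ℕ, 1 ≤ m ∧
        (m : ℝ) ≤ C * (Fintype.card X : ℝ) ^ (1 + 2 / (k : ℝ)) *
          Real.logb 2 (Fintype.card X) ∧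
        ∃ (U : Fin m → Type) (dU : ∀ i, MetricSpace (U i)) (_ : ∀ i, Fintype (U i))
          (f : ∀ i, X → Finset (U i)) (χ : ∀ i, X → U i),
          (∀ i, IsUltrametricSpace (U i) (iU := dU i)) ∧
          (∀ i, IsClanEmbedding X (U i) (f i) (χ i) (16 * k : ℝ) (iY := dU i)) ∧
          ∀ x : X, (∑ i, ((f i x).card : ℝ)) / (m : ℝ) ≤
            C * (Fintype.card X : ℝ) ^ (1 / (k : ℝ)) := by
  refine ⟨12, by norm_num, ?_⟩
  intro X _ _ hn k hk
  have hne : Nonempty X := Fintype.card_pos_iff.mp (by omega)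
  set n : ℝ := (Fintype.card X : ℝ) with hndef
  have hn2 : (2 : ℝ) ≤ n := by rw [hndef]; exact_mod_cast hn
  have hk1 : (1 : ℝ) ≤ k := by exact_mod_cast hk
  have hkpos : (0 : ℝ) < k := by linarith
  set α : ℝ := 2 * (2 * n) ^ (1 / (k : ℝ)) with hα
  have hαpos : 0 < α := by positivity
  have hρ : 0 < n * α := by positivity
  let ι := {P : ClanPack X k // ∀ x, ((P.f x).card : ℝ) ≤ n * α}
  let c : ι → X → ℝ := fun P x => ((P.1.f x).card : ℝ)
  have hw : ∀ w : X → ℝ, (∀ x, 0 < w x) → ∃ i, ∑ x, w x * c i x ≤ α * ∑ x, w x := by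
    intro w hwpos
    have hW : 0 < ∑ x, w x := Finset.sum_pos (fun x _ => hwpos x) Finset.univ_nonempty
    set W := ∑ x, w x with hWdef
    have hμ : ∀ x, 1 ≤ 1 + n / W * w x := by
      intro x
      have := hwpos x
      have : 0 ≤ n / W * w x := by positivity
      linarith
    obtain ⟨P, hP⟩ := clanPack_exists k hk (fun x => 1 + n / W * w x) hμ
    have hsum : ∑ x, (1 + n / W * w x) = 2 * n := by
      rw [Finset.sum_add_distrib, ← Finset.mul_sum, ← hWdef, div_mul_cancel₀ _ hW.ne']
      simp only [Finset.sum_const, Finset.card_univ, nsmul_eq_mul, mul_one]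
      rw [← hndef]; ring
    rw [hsum] at hP
    have hP' : ∑ x, (1 + n / W * w x) * ((P.f x).card : ℝ) ≤ n * α := by
      refine hP.trans (le_of_eq ?_)
      rw [hα]; ring
    refine ⟨⟨P, fun x => ?_⟩, ?_⟩
    · refine le_trans ?_ hP'
      refine le_trans ?_ (Finset.single_le_sum
        (f := fun x => (1 + n / W * w x) * ((P.f x).card : ℝ)) (fun y _ => ?_) (Finset.mem_univ x))
      · exact le_mul_of_one_le_left (by positivity) (hμ x)
      · exact mul_nonneg (zero_le_one.trans (hμ y)) (by positivity)
    · have h2 : n / W * ∑ x, w x * ((P.f x).card : ℝ) ≤ n * α := by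
        refine le_trans ?_ hP'
        rw [Finset.mul_sum]
        refine Finset.sum_le_sum fun x _ => ?_
        have : (0 : ℝ) ≤ ((P.f x).card : ℝ) := by positivity
        nlinarith
      change ∑ x, w x * ((P.f x).card : ℝ) ≤ α * W
      have hnW : 0 < n / W := by positivity
      refine le_of_mul_le_mul_left (h2.trans (le_of_eq ?_)) hnW
      field_simp
  have hlogb : 1 ≤ Real.logb 2 n := by
    rw [Real.le_logb_iff_rpow_le (by norm_num) (by linarith)]
    simpa using hn2
  set L := Real.logb 2 n with hL
  have hlog : Real.log n ≤ L := by
    rw [hL, Real.logb, le_div_iff₀ (Real.log_pos (by norm_num))]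
    have h1 : Real.log 2 ≤ 1 := by linarith [Real.log_two_lt_d9]
    have h2 : 0 ≤ Real.log n := Real.log_nonneg (by linarith)
    nlinarith
  have hnL : 1 ≤ n * L := by nlinarith
  set T := ⌈n * L⌉₊ with hT
  have hT1 : n * L ≤ T := Nat.le_ceil _
  have hT2 : (T : ℝ) ≤ 2 * (n * L) := by
    have := Nat.ceil_lt_add_one (a := n * L) (by linarith)
    linarith
  have hTpos : (0 : ℝ) < T := by linarith
  obtain ⟨s, hs⟩ := clan_mwu c (n * α) α hρ hαpos.le (fun i x => by positivity)
    (fun i x => i.2 x) hw T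
  refine ⟨T, by exact_mod_cast hTpos, ?_, fun t => (s t).1.U, fun t => (s t).1.dU,
    fun t => (s t).1.fU, fun t => (s t).1.f, fun t => (s t).1.χ, fun t => (s t).1.ultra,
    fun t => (s t).1.clan, ?_⟩
  · have hpow : n ≤ n ^ (1 + 2 / (k : ℝ)) := by
      have h : (1 : ℝ) ≤ 1 + 2 / (k : ℝ) := by
        have : 0 < 2 / (k : ℝ) := by positivity
        linarith
      simpa using Real.rpow_le_rpow_of_exponent_le (x := n) (by linarith) h
    calc (T : ℝ) ≤ 2 * (n * L) := hT2
      _ ≤ 12 * (n * L) := by linarith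
      _ ≤ 12 * (n ^ (1 + 2 / (k : ℝ)) * L) := by gcongr
      _ = _ := by ring
  · intro x
    have h1 : Real.exp ((∑ t, c (s t) x) / (n * α)) ≤ n * Real.exp (2 * α / (n * α) * T) :=
      (Finset.single_le_sum (f := fun x => Real.exp ((∑ t, c (s t) x) / (n * α)))
        (fun y _ => (Real.exp_pos _).le) (Finset.mem_univ x)).trans hs
    have h2 := Real.log_le_log (Real.exp_pos _) h1
    rw [Real.log_exp, Real.log_mul (by linarith) (Real.exp_pos _).ne', Real.log_exp,
      div_le_iff₀ hρ] at h2
    have h3 : (Real.log n + 2 * α / (n * α) * T) * (n * α) = n * Real.log n * α + 2 * α * T := by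
      field_simp
    rw [h3] at h2
    have h4 : n * Real.log n * α ≤ T * α := by
      gcongr
      exact le_trans (by gcongr) hT1
    have h5 : α ≤ 4 * n ^ (1 / (k : ℝ)) := by
      rw [hα, Real.mul_rpow (by norm_num) (by linarith)]
      have : (2 : ℝ) ^ (1 / (k : ℝ)) ≤ 2 := by
        have h : 1 / (k : ℝ) ≤ 1 := by rw [div_le_one hkpos]; exact hk1
        simpa using Real.rpow_le_rpow_of_exponent_le (x := (2 : ℝ)) (by norm_num) h
      have h' : 0 ≤ n ^ (1 / (k : ℝ)) := by positivity
      nlinarith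
    rw [div_le_iff₀ hTpos]
    change ∑ t, c (s t) x ≤ _
    nlinarith
end

section
/- Let (X, d_X) be a metric space on n ≥ 2 points, let ρ ≥ 1, α ≥ 1, β > 0 be reals, and let ε ∈ (0,1/2). Suppose that for every probability measure μ on X there exist a metric space (Y_μ, d_{Y_μ}) and a clan embedding (f_μ, χ_μ) of X into Y_μ with multiplicative distortion β such that E_{x∼μ}[|f_μ(x)|] ≤ α and max_{x∈X}|f_μ(x)| ≤ ρ. Then, with T = ⌈4ρα·ln(n)/ε²⌉, there exist metric spaces (Y_1,d_1),…,(Y_T,d_T) and clan embeddings (f^1,χ^1),…,(f^T,χ^T) of X into them, each with multiplicative distortion β, such that for every x ∈ X one has (1/T)·Σ_{t=1}^T |f^t(x)| ≤ α + ε. -/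
theorem mwu_step {X : Type} [Fintype X] (w c : X → ℝ) (ρ α s : ℝ) (hρ : 0 < ρ)
    (hs0 : 0 ≤ s) (hs1 : s ≤ 1) (hw : ∀ x, 0 ≤ w x) (hc0 : ∀ x, 0 ≤ c x) (hc : ∀ x, c x ≤ ρ)
    (hwc : ∑ x, w x * c x ≤ α * ∑ x, w x) :
    ∑ x, w x * Real.exp (s / ρ * c x) ≤ (∑ x, w x) * Real.exp ((s + s ^ 2) * α / ρ) := by
  have h1 : ∀ x, Real.exp (s / ρ * c x) ≤ 1 + (s + s ^ 2) / ρ * c x := by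
    intro x
    obtain ⟨y, hy⟩ : ∃ y, y = c x / ρ := ⟨_, rfl⟩
    have hy0 : 0 ≤ y := hy ▸ div_nonneg (hc0 x) hρ.le
    have hy1 : y ≤ 1 := by rw [hy, div_le_one hρ]; exact hc x
    have e1 : s / ρ * c x = s * y := by rw [hy]; ring
    have e2 : (s + s ^ 2) / ρ * c x = (s + s ^ 2) * y := by rw [hy]; ring
    rw [e1, e2]
    have hsy : |s * y| ≤ 1 := by
      rw [abs_of_nonneg (mul_nonneg hs0 hy0)]; exact mul_le_one₀ hs1 hy0 hy1
    have h2 := (abs_le.1 (Real.abs_exp_sub_one_sub_id_le hsy)).2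
    have h3 : s ^ 2 * (y * y) ≤ s ^ 2 * y :=
      mul_le_mul_of_nonneg_left (by nlinarith) (sq_nonneg s)
    nlinarith
  have hW : 0 ≤ ∑ x, w x := Finset.sum_nonneg fun x _ => hw x
  calc ∑ x, w x * Real.exp (s / ρ * c x)
      ≤ ∑ x, (w x + (s + s ^ 2) / ρ * (w x * c x)) := by
        refine Finset.sum_le_sum fun x _ => ?_
        have := mul_le_mul_of_nonneg_left (h1 x) (hw x)
        linarith
    _ = ∑ x, w x + (s + s ^ 2) / ρ * ∑ x, w x * c x := by
        rw [Finset.sum_add_distrib, Finset.mul_sum]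
    _ ≤ ∑ x, w x + (s + s ^ 2) / ρ * (α * ∑ x, w x) := by
        have : 0 ≤ (s + s ^ 2) / ρ := by positivity
        gcongr
    _ = (∑ x, w x) * ((s + s ^ 2) * α / ρ + 1) := by ring
    _ ≤ _ := mul_le_mul_of_nonneg_left (Real.add_one_le_exp _) hW

/-- multiplicative weights update: given a `(ρ,α,β)`-bounded oracle,
with `T = ⌈4ρα·ln(n)/ε²⌉` there is a list of `T` clan embeddings, each with multiplicative
distortion `β`, whose average clan size at every point is at most `α + ε`. -/
theorem mwu_from_bounded_oracle
    (X : Type) [MetricSpace X] [Fintype X] (hn : 2 ≤ Fintype.card X)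
    (ρ α β ε : ℝ) (hρ : 1 ≤ ρ) (hα : 1 ≤ α) (hβ : 0 < β)
    (hε0 : 0 < ε) (hε1 : ε < 1 / 2)
    (oracle : ∀ μ : X → ℝ, (∀ x, 0 ≤ μ x) → ∑ x, μ x = 1 →
      ∃ (Y : Type) (_ : MetricSpace Y) (f : X → Finset Y) (χ : X → Y),
        IsClanEmbedding X Y f χ β ∧
        (∑ x, μ x * ((f x).card : ℝ)) ≤ α ∧
        ∀ x, ((f x).card : ℝ) ≤ ρ)
    (T : ℕ) (hT : T = ⌈4 * ρ * α * Real.log (Fintype.card X) / ε ^ 2⌉₊) :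
    ∃ (Y : Fin T → Type) (dY : ∀ t, MetricSpace (Y t))
      (f : ∀ t, X → Finset (Y t)) (χ : ∀ t, X → Y t),
      (∀ t, IsClanEmbedding X (Y t) (f t) (χ t) β (iY := dY t)) ∧
      ∀ x : X, (∑ t, ((f t x).card : ℝ)) / (T : ℝ) ≤ α + ε := by
  have hρ0 : 0 < ρ := by linarith
  have hα0 : 0 < α := by linarith
  have hne : Nonempty X := Fintype.card_pos_iff.1 (by omega)
  obtain ⟨s, hs⟩ : ∃ s, s = ε / (2 * α) := ⟨_, rfl⟩
  have hs0 : 0 < s := by rw [hs]; positivity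
  have hs1 : s ≤ 1 := by rw [hs, div_le_one (by positivity)]; linarith
  have hW : ∀ L : X → ℝ, 0 < ∑ x, Real.exp (s / ρ * L x) := fun L =>
    Finset.sum_pos (fun x _ => Real.exp_pos _) Finset.univ_nonempty
  choose Y dY f χ hcl hmean hmax using fun L : X → ℝ =>
    oracle (fun x => Real.exp (s / ρ * L x) / ∑ x, Real.exp (s / ρ * L x))
      (fun x => div_nonneg (Real.exp_pos _).le (hW L).le)
      (by rw [← Finset.sum_div, div_self (hW L).ne'])
  obtain ⟨L, hL0, hLs⟩ : ∃ L : ℕ → X → ℝ, L 0 = (fun _ => 0) ∧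
      ∀ t, L (t + 1) = fun x => L t x + ((f (L t) x).card : ℝ) :=
    ⟨fun t => Nat.rec (fun _ => 0) (fun _ l x => l x + ((f l x).card : ℝ)) t,
      rfl, fun t => rfl⟩
  have hsum : ∀ t x, L t x = ∑ i ∈ Finset.range t, ((f (L i) x).card : ℝ) := by
    intro t x
    induction t with
    | zero => simp [hL0]
    | succ t ih => rw [Finset.sum_range_succ, ← ih, hLs]
  have hpot : ∀ t : ℕ, ∑ x, Real.exp (s / ρ * L t x) ≤
      Fintype.card X * Real.exp (t * ((s + s ^ 2) * α / ρ)) := by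
    intro t
    induction t with
    | zero => simp [hL0]
    | succ t ih =>
      have hst := mwu_step (fun x => Real.exp (s / ρ * L t x))
        (fun x => ((f (L t) x).card : ℝ)) ρ α s hρ0 hs0.le hs1 (fun x => (Real.exp_pos _).le)
        (fun x => Nat.cast_nonneg _) (hmax (L t)) (by
          have h := hmean (L t)
          simp only [div_mul_eq_mul_div (Real.exp _)] at h
          rwa [← Finset.sum_div, div_le_iff₀ (hW _)] at h)
      calc ∑ x, Real.exp (s / ρ * L (t + 1) x)
          = ∑ x, Real.exp (s / ρ * L t x) * Real.exp (s / ρ * ((f (L t) x).card : ℝ)) := by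
            refine Finset.sum_congr rfl fun x _ => ?_
            rw [← Real.exp_add, hLs, mul_add]
        _ ≤ _ := hst
        _ ≤ (Fintype.card X * Real.exp (t * ((s + s ^ 2) * α / ρ))) *
              Real.exp ((s + s ^ 2) * α / ρ) :=
            mul_le_mul_of_nonneg_right ih (Real.exp_pos _).le
        _ = _ := by
            rw [mul_assoc, ← Real.exp_add]; push_cast; ring_nf
  have hn1 : (1 : ℝ) < Fintype.card X := by exact_mod_cast (by omega : 1 < Fintype.card X)
  have hlog : 0 < Real.log (Fintype.card X) := Real.log_pos hn1
  have hTge : 4 * ρ * α * Real.log (Fintype.card X) / ε ^ 2 ≤ (T : ℝ) := by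
    rw [hT]; exact Nat.le_ceil _
  have hT0 : (0 : ℝ) < T := lt_of_lt_of_le (by positivity) hTge
  refine ⟨fun t => Y (L t), fun t => dY (L t), fun t => f (L t), fun t => χ (L t),
    fun t => hcl (L t), fun x => ?_⟩
  rw [Fin.sum_univ_eq_sum_range (fun i => ((f (L i) x).card : ℝ)) T, ← hsum,
    div_le_iff₀ hT0]
  have h1 : Real.exp (s / ρ * L T x) ≤
      Fintype.card X * Real.exp (T * ((s + s ^ 2) * α / ρ)) :=
    (Finset.single_le_sum (f := fun x => Real.exp (s / ρ * L T x))
      (fun x _ => (Real.exp_pos _).le) (Finset.mem_univ x)).trans (hpot T)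
  have h2 : s / ρ * L T x ≤ Real.log (Fintype.card X) + T * ((s + s ^ 2) * α / ρ) := by
    rw [← Real.exp_le_exp, Real.exp_add, Real.exp_log (by linarith)]
    exact h1
  rw [div_le_iff₀ (by positivity)] at hTge
  have h3 : ρ * Real.log (Fintype.card X) ≤ T * (s * (ε / 2)) := by
    have : T * (s * (ε / 2)) = T * ε ^ 2 / (4 * α) := by rw [hs]; field_simp; ring
    rw [this, le_div_iff₀ (by positivity)]
    linarith
  have h4 : s * L T x ≤ ρ * Real.log (Fintype.card X) + T * ((s + s ^ 2) * α) := by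
    have := mul_le_mul_of_nonneg_left h2 hρ0.le
    have e1 : ρ * (s / ρ * L T x) = s * L T x := by field_simp
    have e2 : ρ * (Real.log (Fintype.card X) + T * ((s + s ^ 2) * α / ρ)) =
      ρ * Real.log (Fintype.card X) + T * ((s + s ^ 2) * α) := by field_simp
    rwa [e1, e2] at this
  have h5 : s * α = ε / 2 := by rw [hs]; field_simp
  have h6 : T * ((s + s ^ 2) * α) = s * (T * (α + ε / 2)) := by
    rw [← h5]; ring
  refine le_of_mul_le_mul_left ?_ hs0
  calc s * L T x ≤ T * (s * (ε / 2)) + s * (T * (α + ε / 2)) := by linarith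
    _ = _ := by ring
end

section
/- There is a universal constant c > 0 such that for every ε ∈ (0,1) there is N ∈ ℕ so that for every n ≥ N there exists a metric space (X, d_X) on n points with the following property: every clan embedding (f, χ) of (X, d_X) into a tree metric with multiplicative distortion at most c·(log₂ n)/ε satisfies Σ_{x∈X}|f(x)| ≥ (1+ε)·n. -/
/-- `(Y, dist)` is a tree metric: there is a tree on vertex set `Y` with positive edge
weights whose path-weight distance is `dist`. -/
def IsTreeMetric (Y : Type*) [iY : MetricSpace Y] : Prop :=
  ∃ (T : SimpleGraph Y) (w : Sym2 Y → ℝ),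
    T.IsTree ∧ (∀ e ∈ T.edgeSet, 0 < w e) ∧
    ∀ (u v : Y) (p : T.Walk u v), p.IsPath → dist u v = (p.edges.map w).sum

section TreePart

variable {Y : Type*} [MetricSpace Y]

/-- Additivity of the tree metric along a path. -/
theorem tree_dist_add {T : SimpleGraph Y} {w : Sym2 Y → ℝ}
    (hd : ∀ (u v : Y) (p : T.Walk u v), p.IsPath → dist u v = (p.edges.map w).sum)
    {x y z : Y} (p : T.Walk x y) (q : T.Walk y z) (h : (p.append q).IsPath) :
    dist x z = dist x y + dist y z := by
  rw [hd _ _ _ h, hd _ _ p h.of_append_left, hd _ _ q h.of_append_right]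
  simp [SimpleGraph.Walk.edges_append]

theorem append_isPath {Y : Type*} {T : SimpleGraph Y} {x y z : Y} (p : T.Walk x y) (q : T.Walk y z)
    (hp : p.IsPath) (hq : q.IsPath) (h : ∀ v ∈ p.support, v ∈ q.support → v = y) :
    (p.append q).IsPath := by
  rw [SimpleGraph.Walk.isPath_def, SimpleGraph.Walk.support_append]
  have hq' := hq.support_nodup
  rw [← SimpleGraph.Walk.cons_tail_support] at hq'
  rw [List.nodup_append]
  refine ⟨hp.support_nodup, (List.nodup_cons.1 hq').2, ?_⟩
  intro a ha b hb hab
  subst hab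
  have := h a ha (List.mem_of_mem_tail hb)
  subst this
  exact (List.nodup_cons.1 hq').1 hb

/-- Gate property. -/
theorem tree_gate {T : SimpleGraph Y} {w : Sym2 Y → ℝ} (hT : T.IsTree)
    (hd : ∀ (u v : Y) (p : T.Walk u v), p.IsPath → dist u v = (p.edges.map w).sum)
    {u r : Y} (P : T.Walk u r) (v : Y) :
    ∃ m ∈ P.support, ∀ z ∈ P.support, dist v z = dist v m + dist m z := by
  classical
  obtain ⟨m, hm, hmin⟩ := P.support.toFinset.exists_min_image (fun m => dist v m)
    ⟨u, by simp⟩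
  simp only [List.mem_toFinset] at hm hmin
  refine ⟨m, hm, fun z hz => ?_⟩
  obtain ⟨p, hp, -⟩ := hT.existsUnique_path v m
  let q0 : T.Walk m z := (P.takeUntil m hm).reverse.append (P.takeUntil z hz)
  have hq0 : ∀ x ∈ q0.bypass.support, x ∈ P.support := by
    intro x hx
    have := q0.support_bypass_subset_support hx
    simp only [q0, SimpleGraph.Walk.mem_support_append_iff, SimpleGraph.Walk.support_reverse,
      List.mem_reverse] at this
    rcases this with h | h
    · exact P.support_takeUntil_subset_support hm h
    · exact P.support_takeUntil_subset_support hz h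
  refine tree_dist_add hd p q0.bypass (append_isPath _ _ hp q0.bypass_isPath ?_)
  intro x hx hx'
  have h1 := hmin x (hq0 x hx')
  have h2 : dist v m = dist v x + dist x m := by
    refine tree_dist_add hd (p.takeUntil x hx) (p.dropUntil x hx) ?_
    rwa [SimpleGraph.Walk.take_spec]
  have h3 : dist x m = 0 := le_antisymm (by linarith) dist_nonneg
  exact dist_eq_zero.1 h3

/-- The four point condition. -/
theorem tree_four_point (hY : IsTreeMetric Y) (u r v x : Y) :
    dist v x + dist u r ≤ max (dist v u + dist x r) (dist x u + dist v r) := by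
  classical
  obtain ⟨T, w, hT, -, hd⟩ := hY
  obtain ⟨P, hP, -⟩ := hT.existsUnique_path u r
  have key : ∀ v x m n : Y, ∀ hn : n ∈ P.support, m ∈ (P.takeUntil n hn).support →
      (∀ z ∈ P.support, dist v z = dist v m + dist m z) →
      (∀ z ∈ P.support, dist x z = dist x n + dist n z) →
      dist v x + dist u r ≤ dist x u + dist v r := by
    intro v x m n hn hm hv hx
    have hmP : m ∈ P.support := P.support_takeUntil_subset_support hn hm
    have e1 : dist u n = dist u m + dist m n := by
      refine tree_dist_add hd ((P.takeUntil n hn).takeUntil m hm)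
        ((P.takeUntil n hn).dropUntil m hm) ?_
      rw [SimpleGraph.Walk.take_spec]; exact hP.takeUntil hn
    have e2 : dist u r = dist u m + dist m r := by
      refine tree_dist_add hd (P.takeUntil m hmP) (P.dropUntil m hmP) ?_
      rwa [SimpleGraph.Walk.take_spec]
    have e3 := hv r P.end_mem_support
    have e4 := hx u P.start_mem_support
    have e5 := dist_triangle4 v m n x
    rw [dist_comm n u] at e4
    rw [dist_comm n x] at e5
    linarith
  obtain ⟨m, hm, hmv⟩ := tree_gate hT hd P v
  obtain ⟨n, hn, hnx⟩ := tree_gate hT hd P x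
  by_cases h : m ∈ (P.takeUntil n hn).support
  · exact le_max_of_le_right (key v x m n hn h hmv hnx)
  · have h' : n ∈ (P.takeUntil m hm).support := by
      have h1 : m ∈ (P.dropUntil n hn).support := by
        have : m ∈ ((P.takeUntil n hn).append (P.dropUntil n hn)).support := by
          rwa [SimpleGraph.Walk.take_spec]
        rw [SimpleGraph.Walk.mem_support_append_iff] at this
        tauto
      have h2 : ((P.takeUntil n hn).append ((P.dropUntil n hn).takeUntil m h1)).IsPath := by
        have : ((P.takeUntil n hn).append (((P.dropUntil n hn).takeUntil m h1).append
          ((P.dropUntil n hn).dropUntil m h1))).IsPath := by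
          rw [SimpleGraph.Walk.take_spec, SimpleGraph.Walk.take_spec]; exact hP
        rw [SimpleGraph.Walk.append_assoc] at this
        exact this.of_append_left
      have h3 := (hT.existsUnique_path u m).unique h2 (hP.takeUntil hm)
      rw [← h3, SimpleGraph.Walk.mem_support_append_iff]
      left; simp
    have := key x v n m hm h' hnx hmv
    rw [dist_comm x v] at this
    exact le_max_of_le_left this

/-- Cocycles on the Rips graph of a subset of a tree are coboundaries. -/
theorem tree_cocycle (hY : IsTreeMetric Y) {I : Type*} [DecidableEq I] (q : I → Y) (s : ℝ)
    (Ψ : I → I → ZMod 2) (S : Finset I)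
    (hsym : ∀ i ∈ S, ∀ j ∈ S, Ψ i j = Ψ j i)
    (hzero : ∀ i ∈ S, Ψ i i = 0)
    (hco : ∀ i ∈ S, ∀ j ∈ S, ∀ k ∈ S, dist (q i) (q j) ≤ s → dist (q j) (q k) ≤ s →
      dist (q i) (q k) ≤ s → Ψ i j + Ψ j k = Ψ i k) :
    ∃ F : I → ZMod 2, ∀ i ∈ S, ∀ j ∈ S, dist (q i) (q j) ≤ s → F i + F j = Ψ i j := by
  classical
  induction hc : S.card generalizing S with
  | zero =>
    rw [Finset.card_eq_zero] at hc
    subst hc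
    exact ⟨0, by simp⟩
  | succ n ih =>
    have hne : S.Nonempty := by rw [← Finset.card_pos]; omega
    obtain ⟨i0, hi0⟩ := hne
    obtain ⟨u, hu, hmax⟩ := S.exists_max_image (fun i => dist (q i) (q i0)) ⟨i0, hi0⟩
    have hsub : ∀ i ∈ S.erase u, i ∈ S := fun i hi => Finset.mem_of_mem_erase hi
    obtain ⟨F, hF⟩ := ih (S.erase u)
      (fun i hi j hj => hsym i (hsub i hi) j (hsub j hj))
      (fun i hi => hzero i (hsub i hi))
      (fun i hi j hj k hk => hco i (hsub i hi) j (hsub j hj) k (hsub k hk))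
      (by rw [Finset.card_erase_of_mem hu]; omega)
    have two : ∀ a : ZMod 2, a + a = 0 := by decide
    have hclq : ∀ v ∈ S, ∀ x ∈ S, dist (q v) (q u) ≤ s → dist (q x) (q u) ≤ s →
        dist (q v) (q x) ≤ s := by
      intro v hv x hx h1 h2
      have h4 := tree_four_point hY (q u) (q i0) (q v) (q x)
      have := hmax v hv
      have := hmax x hx
      rcases le_max_iff.1 h4 with h | h <;> linarith
    obtain ⟨c, hc⟩ : ∃ c : ZMod 2, ∀ v ∈ S.erase u, dist (q v) (q u) ≤ s → F v + c = Ψ v u := by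
      by_cases hex : ∃ v ∈ S.erase u, dist (q v) (q u) ≤ s
      · obtain ⟨v, hv, hvu⟩ := hex
        refine ⟨F v + Ψ v u, fun x hx hxu => ?_⟩
        have hxv := hclq x (hsub x hx) v (hsub v hv) hxu hvu
        rw [← add_assoc, hF x hx v hv hxv]
        exact hco x (hsub x hx) v (hsub v hv) u hu hxv hvu hxu
      · push Not at hex
        exact ⟨0, fun v hv h => absurd h (not_le.2 (hex v hv))⟩
    refine ⟨Function.update F u c, fun i hi j hj hij => ?_⟩
    by_cases hiu : i = u
    · by_cases hju : j = u
      · subst hiu; subst hju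
        simp [two, hzero _ hi]
      · subst hiu
        have := hc j (Finset.mem_erase.2 ⟨hju, hj⟩) (by rwa [dist_comm])
        simp only [Function.update_self, Function.update_of_ne hju]
        rw [add_comm, this, hsym j hj i hi]
    · by_cases hju : j = u
      · subst hju
        have := hc i (Finset.mem_erase.2 ⟨hiu, hi⟩) hij
        simpa only [Function.update_self, Function.update_of_ne hiu] using this
      · simp only [Function.update_of_ne hiu, Function.update_of_ne hju]
        exact hF i (Finset.mem_erase.2 ⟨hiu, hi⟩) j (Finset.mem_erase.2 ⟨hju, hj⟩) hij

end TreePart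

section CirclePart

theorem int_natAbs_sub_comm (x y : ℤ) : (x - y).natAbs = (y - x).natAbs := by omega

/-- Distance on a circle of length `G`, for representatives differing by at most `G`. -/
def circD (G : ℕ) (z : ℤ) : ℕ := min z.natAbs (G - z.natAbs)

variable {X E : Type*} [Fintype E]

open Classical in
/-- The metric induced by a family of circle-valued maps. -/
noncomputable def circMet (G : ℕ) (ψ : E → X → ℤ) (x y : X) : ℕ :=
  max (Finset.univ.sup fun e => circD G (ψ e x - ψ e y)) (if x = y then 0 else 1)

theorem circD_le_circMet (G : ℕ) (ψ : E → X → ℤ) (x y : X) (e : E) :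
    circD G (ψ e x - ψ e y) ≤ circMet G ψ x y :=
  le_max_of_le_left (Finset.le_sup (f := fun e => circD G (ψ e x - ψ e y)) (Finset.mem_univ e))

/-- The metric space structure. -/
@[reducible]
noncomputable def circSpace (G : ℕ) (ψ : E → X → ℤ)
    (hr : ∀ e x y, (ψ e x - ψ e y).natAbs < G) : MetricSpace X where
  dist x y := (circMet G ψ x y : ℝ)
  dist_self x := by simp [circMet, circD]
  dist_comm x y := by
    have : circMet G ψ x y = circMet G ψ y x := by
      unfold circMet circD
      congr 1
      · refine Finset.sup_congr rfl fun e _ => ?_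
        rw [int_natAbs_sub_comm]
      · by_cases h : x = y
        · rw [if_pos h, if_pos h.symm]
        · rw [if_neg h, if_neg (Ne.symm h)]
    rw [this]
  dist_triangle x y z := by
    norm_cast
    unfold circMet
    refine max_le (Finset.sup_le fun e _ => ?_) ?_
    · have h1 := circD_le_circMet G ψ x y e
      have h2 := circD_le_circMet G ψ y z e
      have h3 := hr e x y
      have h4 := hr e y z
      have h5 := hr e x z
      refine le_trans ?_ (add_le_add h1 h2)
      unfold circD
      omega
    · by_cases h1 : x = y <;> by_cases h2 : y = z <;> by_cases h3 : x = z <;> simp_all <;> omega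
  eq_of_dist_eq_zero {x y} h := by
    by_contra hne
    have h' : circMet G ψ x y = 0 := by exact_mod_cast h
    unfold circMet at h'
    simp [hne] at h'

/-- The main abstract lower bound. -/
theorem circ_lower_bound (G : ℕ) (hG : 3 ≤ G) (ψ : E → X → ℤ) (a b : E → X)
    (hr : ∀ e x y, (ψ e x - ψ e y).natAbs < G)
    (h1 : ∀ e, (ψ e (a e) - ψ e (b e)).natAbs = G - 1)
    (h2 : ∀ e e', e' ≠ e → (ψ e (a e') - ψ e (b e')).natAbs ≤ 1)
    (X0 : Finset X) (ha : ∀ e, a e ∈ X0) (hb : ∀ e, b e ∈ X0)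
    (Y : Type*) [iY : MetricSpace Y] (hY : IsTreeMetric Y) (t : ℝ) (ht0 : 0 ≤ t) (ht : 3 * t < G)
    (f : X → Finset Y) (χ : X → Y)
    (hf : @IsClanEmbedding X Y (circSpace G ψ hr) iY f χ t) :
    Fintype.card E ≤ ∑ x ∈ X0, (f x).card := by
  classical
  let _ := circSpace G ψ hr
  obtain ⟨⟨-, -, hdom⟩, hχ, hdist⟩ := hf
  have hle1 : ∀ e, dist (a e) (b e) ≤ 1 := by
    intro e
    change ((circMet G ψ (a e) (b e) : ℕ) : ℝ) ≤ 1
    norm_cast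
    refine max_le (Finset.sup_le fun e' _ => ?_) (by split_ifs <;> simp)
    unfold circD
    by_cases he : e' = e
    · subst he
      have := h1 e'
      omega
    · have := h2 e' e (Ne.symm he)
      omega
  let S : Finset (Σ _ : X, Y) := X0.sigma f
  let θ : E → X → X → ZMod 2 := fun e x y =>
    if G < 2 * (ψ e x - ψ e y).natAbs then 1 else 0
  have hclose : ∀ i ∈ S, ∀ j ∈ S, dist i.2 j.2 ≤ t → ∀ e,
      3 * circD G (ψ e i.1 - ψ e j.1) < G := by
    intro i hi j hj hij e
    have hd : dist i.1 j.1 ≤ t := by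
      by_cases h : i.1 = j.1
      · rw [h, dist_self]; exact ht0
      · exact (hdom _ _ h _ (Finset.mem_sigma.1 hi).2 _ (Finset.mem_sigma.1 hj).2).trans hij
    have h3 : ((circMet G ψ i.1 j.1 : ℕ) : ℝ) ≤ t := hd
    have h4 : ((circD G (ψ e i.1 - ψ e j.1) : ℕ) : ℝ) ≤ circMet G ψ i.1 j.1 := by
      exact_mod_cast circD_le_circMet G ψ i.1 j.1 e
    have : ((3 * circD G (ψ e i.1 - ψ e j.1) : ℕ) : ℝ) < G := by push_cast; linarith
    exact_mod_cast this
  have hex : ∀ φ : E → ZMod 2, ∃ F : (Σ _ : X, Y) → ZMod 2, ∀ i ∈ S, ∀ j ∈ S,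
      dist i.2 j.2 ≤ t → F i + F j = ∑ e, φ e * θ e i.1 j.1 := by
    intro φ
    refine tree_cocycle hY (fun i : (Σ _ : X, Y) => i.2) t
      (fun i j => ∑ e, φ e * θ e i.1 j.1) S ?_ ?_ ?_
    · intro i _ j _
      refine Finset.sum_congr rfl fun e _ => ?_
      simp only [θ]
      rw [int_natAbs_sub_comm]
    · intro i _
      simp [θ]
    · intro i hi j hj k hk hij hjk hik
      rw [← Finset.sum_add_distrib]
      refine Finset.sum_congr rfl fun e _ => ?_
      rw [← mul_add]
      congr 1
      have c1 := hclose i hi j hj hij e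
      have c2 := hclose j hj k hk hjk e
      have c3 := hclose i hi k hk hik e
      have r1 := hr e i.1 j.1
      have r2 := hr e j.1 k.1
      have r3 := hr e i.1 k.1
      have e11 : (1 + 1 : ZMod 2) = 0 := by decide
      simp only [θ]
      unfold circD at c1 c2 c3
      split_ifs <;> first | (simp [e11]; done) | (exfalso; omega)
  choose F hF using hex
  choose b' hb' hbd using fun e => hdist (a e) (b e)
  have hdet : ∀ φ e, F φ ⟨b e, b' e⟩ + F φ ⟨a e, χ (a e)⟩ = φ e := by
    intro φ e
    have m1 : (⟨b e, b' e⟩ : Σ _ : X, Y) ∈ S := Finset.mem_sigma.2 ⟨hb e, hb' e⟩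
    have m2 : (⟨a e, χ (a e)⟩ : Σ _ : X, Y) ∈ S := Finset.mem_sigma.2 ⟨ha e, hχ _⟩
    rw [hF φ _ m1 _ m2 ((hbd e).trans (by nlinarith [hle1 e]))]
    rw [Finset.sum_eq_single e]
    · have := h1 e
      rw [int_natAbs_sub_comm] at this
      simp only [θ]
      rw [if_pos (by omega), mul_one]
    · intro e' _ hne
      have := h2 e' e (Ne.symm hne)
      rw [int_natAbs_sub_comm] at this
      simp only [θ]
      rw [if_neg (by omega), mul_zero]
    · simp
  have hinj : Function.Injective (fun (φ : E → ZMod 2) (i : S) => F φ i) := by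
    intro φ φ' h
    funext e
    have m1 : (⟨b e, b' e⟩ : Σ _ : X, Y) ∈ S := Finset.mem_sigma.2 ⟨hb e, hb' e⟩
    have m2 : (⟨a e, χ (a e)⟩ : Σ _ : X, Y) ∈ S := Finset.mem_sigma.2 ⟨ha e, hχ _⟩
    rw [← hdet φ e, ← hdet φ' e]
    have g1 := congrFun h ⟨_, m1⟩
    have g2 := congrFun h ⟨_, m2⟩
    simp only at g1 g2
    rw [g1, g2]
  have hcard := Fintype.card_le_of_injective _ hinj
  simp only [Fintype.card_fun, ZMod.card, Fintype.card_coe] at hcard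
  have := (Nat.pow_le_pow_iff_right (by norm_num : 1 < 2)).1 hcard
  simpa [S, Finset.card_sigma] using this

end CirclePart

section BasePart

/-- Vertices within `i` steps of `u`. -/
theorem ball_card {V : Type*} [Fintype V] (H : SimpleGraph V) [DecidableRel H.Adj]
    (hdeg : ∀ v, H.degree v ≤ 5) (u : V) (i : ℕ) :
    ∃ B : Finset V, B.card ≤ 6 ^ i ∧ ∀ v, ∀ p : H.Walk u v, p.length ≤ i → v ∈ B := by
  classical
  induction i with
  | zero =>
    refine ⟨{u}, by simp, fun v p hp => ?_⟩
    have := SimpleGraph.Walk.eq_of_length_eq_zero (Nat.le_zero.1 hp)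
    simp [this]
  | succ i ih =>
    obtain ⟨B, hB, hB'⟩ := ih
    refine ⟨B ∪ B.biUnion fun v => H.neighborFinset v, ?_, fun v p hp => ?_⟩
    · refine (Finset.card_union_le _ _).trans ?_
      have : (B.biUnion fun v => H.neighborFinset v).card ≤ B.card * 5 := by
        refine Finset.card_biUnion_le_card_mul _ _ _ fun v _ => ?_
        rw [SimpleGraph.card_neighborFinset_eq_degree]; exact hdeg v
      rw [pow_succ]; omega
    · by_cases hnil : p.Nil
      · have : u ∈ B := hB' u SimpleGraph.Walk.nil (by simp)
        rw [← hnil.eq]; exact Finset.mem_union_left _ this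
      · refine Finset.mem_union_right _ (Finset.mem_biUnion.2 ⟨p.penultimate, ?_, ?_⟩)
        · refine hB' _ p.dropLast ?_
          simp; omega
        · simpa using p.adj_penultimate hnil

theorem cycle_through {V : Type*} (H : SimpleGraph V) {u v : V}
    {x : V} (c : (H ⊔ SimpleGraph.edge u v).Walk x x) (hc : c.IsCycle) (he : s(u, v) ∈ c.edges) :
    ∃ p : H.Walk u v, p.length ≤ c.length := by
  classical
  have hu : u ∈ c.support := c.fst_mem_support_of_mem_edges he
  have hv : v ∈ (c.rotate u hu).support := by
    rw [SimpleGraph.Walk.mem_support_rotate_iff]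
    exact c.snd_mem_support_of_mem_edges he
  have hlen : (c.rotate u hu).length = c.length := SimpleGraph.Walk.length_rotate ..
  have htr : (c.rotate u hu).IsTrail := hc.isTrail.rotate hu
  generalize c.rotate u hu = d at hv hlen htr
  have hdis := htr.disjoint_edges_takeUntil_dropUntil hv
  have hl : (d.takeUntil v hv).length + (d.dropUntil v hv).length = d.length := by
    rw [← SimpleGraph.Walk.length_append, SimpleGraph.Walk.take_spec]
  have hall : ∀ {x y : V} (q : (H ⊔ SimpleGraph.edge u v).Walk x y), s(u, v) ∉ q.edges →
      ∀ e ∈ q.edges, e ∈ H.edgeSet := by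
    intro x y q hq e hec
    have h1 := q.edges_subset_edgeSet hec
    rw [SimpleGraph.edgeSet_sup] at h1
    rcases h1 with h1 | h1
    · exact h1
    · have := SimpleGraph.edgeSet_edge_subset h1
      rw [Set.mem_singleton_iff] at this
      exact absurd (this ▸ hec) hq
  by_cases h : s(u, v) ∈ (d.takeUntil v hv).edges
  · have h' : s(u, v) ∉ (d.dropUntil v hv).edges := fun h2 => hdis h h2
    refine ⟨((d.dropUntil v hv).transfer H (hall _ h')).reverse, ?_⟩
    simp only [SimpleGraph.Walk.length_reverse, SimpleGraph.Walk.length_transfer]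
    omega
  · refine ⟨(d.takeUntil v hv).transfer H (hall _ h), ?_⟩
    simp only [SimpleGraph.Walk.length_transfer]
    omega

/-- Maximal bounded degree graph of large girth. -/
theorem exists_base_graph (m g : ℕ) (hg : 3 ≤ g) (hm : 5 * 6 ^ g ≤ m) :
    ∃ H : SimpleGraph (Fin m), (∀ x, ∀ c : H.Walk x x, c.IsCycle → g < c.length) ∧
      2 * m ≤ H.edgeSet.ncard := by
  classical
  let P : SimpleGraph (Fin m) → Prop := fun H =>
    (∀ v, (H.neighborSet v).ncard ≤ 5) ∧ ∀ x, ∀ c : H.Walk x x, c.IsCycle → g < c.length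
  obtain ⟨H, -, hH⟩ := Finite.exists_le_maximal (p := P) (a := ⊥) (by
    refine ⟨by simp, fun x c hc => ?_⟩
    exact absurd hc (SimpleGraph.isAcyclic_bot c))
  obtain ⟨⟨hdeg, hgir⟩, hmax⟩ := hH
  refine ⟨H, hgir, ?_⟩
  have hdegN : ∀ v, H.degree v = (H.neighborSet v).ncard := by
    intro v
    rw [← SimpleGraph.card_neighborSet_eq_degree, ← Nat.card_coe_set_eq, Nat.card_eq_fintype_card]
  have hdeg5 : ∀ v, H.degree v ≤ 5 := fun v => by rw [hdegN]; exact hdeg v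
  let L : Finset (Fin m) := Finset.univ.filter fun v => H.degree v < 5
  have hL : L.card ≤ 6 ^ g := by
    rcases L.eq_empty_or_nonempty with h | ⟨u, hu⟩
    · simp [h]
    obtain ⟨B, hB, hB'⟩ := ball_card H hdeg5 u g
    refine (Finset.card_le_card fun v hv => ?_).trans hB
    by_contra hvB
    have hno : ∀ p : H.Walk u v, g < p.length := by
      intro p
      by_contra hp
      exact hvB (hB' v p (not_lt.1 hp))
    have huv : u ≠ v := by
      rintro rfl
      simpa using hno SimpleGraph.Walk.nil
    have hadj : ¬ H.Adj u v := by
      intro h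
      have := hno h.toWalk
      simp at this
      omega
    have hlt := SimpleGraph.lt_sup_edge _ _ _ huv hadj
    refine hlt.not_ge (hmax ⟨fun w => ?_, fun x c hc => ?_⟩ hlt.le)
    · have hu5 : (H.neighborSet u).ncard < 5 := by
        rw [← hdegN]; exact (Finset.mem_filter.1 hu).2
      have hv5 : (H.neighborSet v).ncard < 5 := by
        rw [← hdegN]; exact (Finset.mem_filter.1 hv).2
      by_cases hwu : w = u
      · subst hwu
        have : (H ⊔ SimpleGraph.edge w v).neighborSet w ⊆ insert v (H.neighborSet w) := by
          intro z hz
          simp [SimpleGraph.edge_adj] at hz ⊢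
          tauto
        refine (Set.ncard_le_ncard this (Set.toFinite _)).trans
          ((Set.ncard_insert_le _ _).trans (by omega))
      · by_cases hwv : w = v
        · subst hwv
          have : (H ⊔ SimpleGraph.edge u w).neighborSet w ⊆ insert u (H.neighborSet w) := by
            intro z hz
            simp [SimpleGraph.edge_adj] at hz ⊢
            tauto
          refine (Set.ncard_le_ncard this (Set.toFinite _)).trans
            ((Set.ncard_insert_le _ _).trans (by omega))
        · have : (H ⊔ SimpleGraph.edge u v).neighborSet w ⊆ H.neighborSet w := by
            intro z hz
            simp [SimpleGraph.edge_adj] at hz ⊢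
            tauto
          exact (Set.ncard_le_ncard this (Set.toFinite _)).trans (hdeg w)
    · by_cases he : s(u, v) ∈ c.edges
      · obtain ⟨p, hp⟩ := cycle_through H c hc he
        have := hno p
        omega
      · have hall : ∀ e ∈ c.edges, e ∈ H.edgeSet := by
          intro e hec
          have h1 := c.edges_subset_edgeSet hec
          rw [SimpleGraph.edgeSet_sup] at h1
          rcases h1 with h1 | h1
          · exact h1
          · have := SimpleGraph.edgeSet_edge_subset h1
            rw [Set.mem_singleton_iff] at this
            exact absurd (this ▸ hec) he
        have := hgir x (c.transfer H hall) (hc.transfer hall)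
        simpa using this
  have hsum := H.sum_degrees_eq_twice_card_edges
  have h5 : 5 * (Finset.univ \ L).card ≤ ∑ v, H.degree v := by
    refine le_trans ?_ (Finset.sum_le_sum_of_subset (Finset.sdiff_subset (s := Finset.univ) (t := L)))
    rw [mul_comm, ← smul_eq_mul]
    refine Finset.card_nsmul_le_sum _ _ _ fun v hv => ?_
    simp [L] at hv
    exact hv
  have h6 : (Finset.univ \ L).card = m - L.card := by
    rw [Finset.card_sdiff_of_subset (Finset.subset_univ _)]; simp
  have h7 : H.edgeSet.ncard = H.edgeFinset.card := by
    rw [← SimpleGraph.coe_edgeFinset, Set.ncard_coe_finset]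
  omega

/-- The combinatorial data extracted from the graph. -/
theorem exists_base (m g : ℕ) (hg : 3 ≤ g) (hm : 5 * 6 ^ g ≤ m) :
    ∃ (a b : Fin (2 * m) → Fin m) (ψ : Fin (2 * m) → Fin m → ℕ),
      (∀ e v, ψ e v ≤ g) ∧ (∀ e, ψ e (a e) = 0) ∧ (∀ e, ψ e (b e) = g) ∧
      ∀ e e', e' ≠ e → ψ e (a e') ≤ ψ e (b e') + 1 ∧ ψ e (b e') ≤ ψ e (a e') + 1 := by
  classical
  obtain ⟨H, hgir, hcard⟩ := exists_base_graph m g hg hm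
  have : Nonempty (Fin (2 * m) ↪ H.edgeSet) := by
    rw [Function.Embedding.nonempty_iff_card_le] 
    rw [Fintype.card_fin, ← Nat.card_eq_fintype_card, Nat.card_coe_set_eq]
    exact hcard
  obtain ⟨ι⟩ := this
  let K : Fin (2 * m) → SimpleGraph (Fin m) := fun e => H.deleteEdges {(ι e).1}
  let a : Fin (2 * m) → Fin m := fun e => (Quot.out (ι e).1).1
  let b : Fin (2 * m) → Fin m := fun e => (Quot.out (ι e).1).2
  have hab : ∀ e, s(a e, b e) = (ι e).1 := fun e => Quot.out_eq (ι e).1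
  have hadj : ∀ e, H.Adj (a e) (b e) := by
    intro e
    rw [← SimpleGraph.mem_edgeSet, hab]
    exact (ι e).2
  let ψ : Fin (2 * m) → Fin m → ℕ := fun e v => (min ((K e).edist (a e) v) (g : ℕ∞)).toNat
  have hcoe : ∀ e v, (ψ e v : ℕ∞) = min ((K e).edist (a e) v) (g : ℕ∞) := by
    intro e v
    refine ENat.natCast_toNat (ne_top_of_le_ne_top (ENat.natCast_ne_top g) (min_le_right _ _))
  have hlip : ∀ e x y, (K e).Adj x y → ψ e y ≤ ψ e x + 1 := by
    intro e x y hxy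
    have h1 : (K e).edist (a e) y ≤ (K e).edist (a e) x + 1 := by
      refine (SimpleGraph.edist_triangle (v := x)).trans ?_
      rw [SimpleGraph.edist_eq_one_iff_adj.2 hxy]
    have : (ψ e y : ℕ∞) ≤ (ψ e x : ℕ∞) + 1 := by
      rw [hcoe, hcoe]
      rcases le_total ((K e).edist (a e) x) g with h | h
      · rw [min_eq_left h]
        exact (min_le_left _ _).trans h1
      · rw [min_eq_right h]
        exact (min_le_right _ _).trans le_self_add
    exact_mod_cast this
  refine ⟨a, b, ψ, ?_, ?_, ?_, ?_⟩
  · intro e v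
    have := hcoe e v
    have h2 : (ψ e v : ℕ∞) ≤ g := by rw [this]; exact min_le_right _ _
    exact_mod_cast h2
  · intro e
    simp [ψ]
  · intro e
    have : (g : ℕ∞) ≤ (K e).edist (a e) (b e) := by
      refine le_iInf fun w => ?_
      have hw : s(a e, b e) ∉ w.bypass.edges := by
        intro hmem
        have := w.bypass.edges_subset_edgeSet hmem
        simp [K, SimpleGraph.edgeSet_deleteEdges, hab] at this
      have hle : K e ≤ H := SimpleGraph.deleteEdges_le _
      let w' : H.Walk (a e) (b e) := w.bypass.mapLe hle
      have hw' : w'.IsPath := by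
        simpa [w'] using w.bypass_isPath
      have hcyc : (SimpleGraph.Walk.cons (hadj e).symm w').IsCycle := by
        rw [SimpleGraph.Walk.cons_isCycle_iff]
        refine ⟨hw', ?_⟩
        rw [Sym2.eq_swap]
        simpa [w'] using hw
      have h3 := hgir _ _ hcyc
      have h4 := w.length_bypass_le_length
      simp [w'] at h3
      exact_mod_cast (by omega : g ≤ w.length)
    simp only [ψ]
    rw [min_eq_right this]
    simp
  · intro e e' hne
    have hK : (K e).Adj (a e') (b e') := by
      simp only [K, SimpleGraph.deleteEdges_adj, Set.mem_singleton_iff]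
      refine ⟨hadj e', ?_⟩
      rw [hab]
      intro h
      exact hne (ι.injective (Subtype.ext h))
    exact ⟨hlip e _ _ hK.symm, hlip e _ _ hK⟩

end BasePart

section SubdivPart

/-- Points of the subdivided graph. -/
def subPos {m K r : ℕ} (a b : Fin (2 * m) → Fin m) (e : Fin (2 * m)) (j : ℕ) :
    (Fin m ⊕ (Fin (2 * m) × Fin K)) ⊕ Fin r :=
  if j = 0 then .inl (.inl (a e)) else
    if h : j - 1 < K then .inl (.inr (e, ⟨j - 1, h⟩)) else .inl (.inl (b e))

/-- Values along a subdivided edge. -/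
def subVal {m : ℕ} (g K : ℕ) (a b : Fin (2 * m) → Fin m) (ψ : Fin (2 * m) → Fin m → ℕ)
    (e : Fin (2 * m)) (i : ℕ) (e' : Fin (2 * m)) (J : ℕ) : ℤ :=
  if e' = e then (if J ≤ i then -(J : ℤ) else ((K : ℤ) + 1) * g + (K + 1) - J)
  else ((K : ℤ) + 1) * ψ e (a e') + J * ((ψ e (b e') : ℤ) - ψ e (a e'))

/-- The circle-valued maps of the subdivided graph. -/
def subPsi {m r : ℕ} (g K : ℕ) (a b : Fin (2 * m) → Fin m) (ψ : Fin (2 * m) → Fin m → ℕ)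
    (p : Fin (2 * m) × Fin (K + 1)) : (Fin m ⊕ (Fin (2 * m) × Fin K)) ⊕ Fin r → ℤ
  | .inl (.inl v) => ((K : ℤ) + 1) * ψ p.1 v
  | .inl (.inr (e', j)) => subVal g K a b ψ p.1 p.2 e' (j + 1)
  | .inr _ => 0

theorem subPsi_pos {m r : ℕ} (g K : ℕ) (a b : Fin (2 * m) → Fin m)
    (ψ : Fin (2 * m) → Fin m → ℕ) (ha : ∀ e, ψ e (a e) = 0) (hb : ∀ e, ψ e (b e) = g)
    (p : Fin (2 * m) × Fin (K + 1)) (e' : Fin (2 * m)) (J : ℕ) (hJ : J ≤ K + 1) :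
    subPsi (r := r) g K a b ψ p (subPos a b e' J) = subVal g K a b ψ p.1 p.2 e' J := by
  obtain ⟨e, i⟩ := p
  unfold subPos
  split_ifs with h1 h2
  · subst h1
    by_cases he : e' = e
    · subst he
      simp [subPsi, subVal, ha]
    · simp [subPsi, subVal, he]
  · have : J - 1 + 1 = J := by omega
    simp [subPsi, this]
  · have hJ' : J = K + 1 := by omega
    subst hJ'
    have hi : ¬ (K + 1 ≤ (i : ℕ)) := by have := i.2; omega
    by_cases he : e' = e
    · subst he
      simp [subPsi, subVal, hb, hi]
    · simp [subPsi, subVal, he]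
      ring

theorem exists_space (m g K r : ℕ) (hg : 3 ≤ g) (hm : 5 * 6 ^ g ≤ m) :
    ∃ (X : Type) (_ : MetricSpace X) (_ : Fintype X), Fintype.card X = m + 2 * m * K + r ∧
      ∀ (Y : Type) [MetricSpace Y] (f : X → Finset Y) (χ : X → Y) (t : ℝ),
        0 ≤ t → 3 * t < ((K + 1) * (g + 1) : ℕ) → IsTreeMetric Y → IsClanEmbedding X Y f χ t →
        2 * m * (K + 1) + r ≤ ∑ x, (f x).card := by
  classical
  obtain ⟨a, b, ψ, hle, ha, hb, hlip⟩ := exists_base m g hg hm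
  let X := (Fin m ⊕ (Fin (2 * m) × Fin K)) ⊕ Fin r
  let Ψ : Fin (2 * m) × Fin (K + 1) → X → ℤ := subPsi g K a b ψ
  let a' : Fin (2 * m) × Fin (K + 1) → X := fun p => subPos a b p.1 p.2
  let b' : Fin (2 * m) × Fin (K + 1) → X := fun p => subPos a b p.1 (p.2 + 1)
  have hpos := subPsi_pos (r := r) g K a b ψ ha hb
  have hrange : ∀ p x, -(p.2 : ℤ) ≤ Ψ p x ∧ Ψ p x ≤ ((K : ℤ) + 1) * g + K - p.2 := by
    rintro ⟨e, i⟩ x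
    have hi : (i : ℤ) ≤ K := by have := i.2; omega
    have hi0 : (0 : ℤ) ≤ i := by positivity
    have hK0 : (0 : ℤ) ≤ K := by positivity
    have hg0 : (0 : ℤ) ≤ ((K : ℤ) + 1) * g := by positivity
    rcases x with (v | ⟨e', j⟩) | q
    · have h1 : (ψ e v : ℤ) ≤ g := by exact_mod_cast hle e v
      have h2 : ((K : ℤ) + 1) * ψ e v ≤ ((K : ℤ) + 1) * g := by gcongr
      have h3 : (0 : ℤ) ≤ ((K : ℤ) + 1) * ψ e v := by positivity
      simp only [Ψ, subPsi]
      omega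
    · simp only [Ψ, subPsi, subVal]
      have hj := j.2
      split_ifs with h1 h2
      · push_cast; omega
      · push_cast; omega
      · have h1 : (ψ e (a e') : ℤ) ≤ g := by exact_mod_cast hle e _
        have h2 : (ψ e (b e') : ℤ) ≤ g := by exact_mod_cast hle e _
        have h1' : (0 : ℤ) ≤ ψ e (a e') := by positivity
        have h2' : (0 : ℤ) ≤ ψ e (b e') := by positivity
        have hj' : (0 : ℤ) ≤ (K : ℤ) - j := by omega
        have hj0 : (0 : ℤ) ≤ (j : ℤ) + 1 := by positivity
        push_cast
        have p1 := mul_nonneg hj' h1'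
        have p2 := mul_nonneg hj0 h2'
        have p3 := mul_nonneg hj' (sub_nonneg.2 h1)
        have p4 := mul_nonneg hj0 (sub_nonneg.2 h2)
        constructor <;> nlinarith
    · simp only [Ψ, subPsi]
      omega
  have hGz : (((K + 1) * (g + 1) : ℕ) : ℤ) = ((K : ℤ) + 1) * g + K + 1 := by push_cast; ring
  have hr : ∀ p x y, (Ψ p x - Ψ p y).natAbs < (K + 1) * (g + 1) := by
    intro p x y
    have h1 := hrange p x
    have h2 := hrange p y
    zify
    rw [abs_lt]
    push_cast at hGz
    constructor <;> linarith
  have h1 : ∀ p, (Ψ p (a' p) - Ψ p (b' p)).natAbs = (K + 1) * (g + 1) - 1 := by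
    rintro ⟨e, i⟩
    have hi := i.2
    have q1 := hpos (e, i) e i (by omega)
    have q2 := hpos (e, i) e (i + 1) (by omega)
    simp only [Ψ, a', b']
    rw [q1, q2]
    simp only [subVal, if_true, le_refl]
    rw [if_neg (by omega)]
    push_cast
    have hg0 : (0 : ℤ) ≤ ((K : ℤ) + 1) * g := by positivity
    omega
  have h2 : ∀ p p', p' ≠ p → (Ψ p (a' p') - Ψ p (b' p')).natAbs ≤ 1 := by
    rintro ⟨e, i⟩ ⟨e', i'⟩ hne
    have hi := i'.2
    have q1 := hpos (e, i) e' i' (by omega)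
    have q2 := hpos (e, i) e' (i' + 1) (by omega)
    simp only [Ψ, a', b']
    rw [q1, q2]
    simp only [subVal]
    by_cases he : e' = e
    · subst he
      have hii : (i' : ℕ) ≠ i := by
        intro h
        exact hne (by rw [Fin.ext h])
      simp only [if_true]
      push_cast
      split_ifs <;> omega
    · simp only [if_neg he]
      have := hlip e e' he
      push_cast
      have : ((K : ℤ) + 1) * ψ e (a e') + i' * ((ψ e (b e') : ℤ) - ψ e (a e')) -
          (((K : ℤ) + 1) * ψ e (a e') + (i' + 1) * ((ψ e (b e') : ℤ) - ψ e (a e'))) =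
          (ψ e (a e') : ℤ) - ψ e (b e') := by ring
      rw [this]
      omega
  have hG3 : 3 ≤ (K + 1) * (g + 1) := by nlinarith
  refine ⟨X, circSpace _ Ψ hr, inferInstance, by simp [X], ?_⟩
  intro Y _ f χ t ht0 ht hY hf
  have hmem : ∀ e j, (subPos a b e j : X) ∈
      (Finset.univ : Finset (Fin m ⊕ (Fin (2 * m) × Fin K))).map Function.Embedding.inl := by
    intro e j
    unfold subPos
    split_ifs <;> simp
  have key := circ_lower_bound _ hG3 Ψ a' b' hr h1 h2
    ((Finset.univ : Finset (Fin m ⊕ (Fin (2 * m) × Fin K))).map Function.Embedding.inl)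
    (fun e => hmem _ _) (fun e => hmem _ _) Y hY t ht0 ht f χ hf
  rw [Finset.sum_map] at key
  have hrest : r ≤ ∑ q : Fin r, (f (.inr q)).card := by
    calc r = ∑ q : Fin r, 1 := by simp
      _ ≤ _ := Finset.sum_le_sum fun q _ => Finset.card_pos.2 (hf.1.1 _)
  rw [Fintype.sum_sum_type]
  simp only [Fintype.card_prod, Fintype.card_fin] at key
  exact add_le_add key hrest

end SubdivPart

/-- lower bound. There is some metric space on `n` points for which every
clan embedding into a (finite) tree metric with multiplicative distortion
`c·log₂(n)/ε` must have total clan size at least `(1+ε)·n`. -/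
theorem clan_embedding_tree_lower_bound_eps :
    ∃ c : ℝ, 0 < c ∧
      ∀ ε : ℝ, 0 < ε → ε < 1 →
      ∃ N : ℕ, ∀ n : ℕ, N ≤ n →
      ∃ (X : Type) (_ : MetricSpace X) (_ : Fintype X), Fintype.card X = n ∧
        ∀ (Y : Type) [MetricSpace Y] [Fintype Y]
          (f : X → Finset Y) (χ : X → Y),
          IsTreeMetric Y →
          IsClanEmbedding X Y f χ (c * Real.logb 2 n / ε) →
          (1 + ε) * (n : ℝ) ≤ ∑ x, ((f x).card : ℝ) := by
  refine ⟨1 / 200, by norm_num, fun ε hε0 hε1 => ⟨⌈1000000 / ε ^ 2⌉₊, fun n hn => ?_⟩⟩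
  have hn1 : 1000000 / ε ^ 2 ≤ (n : ℝ) := (Nat.le_ceil _).trans (by exact_mod_cast hn)
  have hn2 : 1000000 ≤ ε ^ 2 * n := by
    rw [div_le_iff₀ (by positivity)] at hn1
    linarith
  have hn0 : (0 : ℝ) ≤ n := by positivity
  have hεn : 1000000 ≤ ε * n := by
    have : ε ^ 2 * n ≤ ε * n := by
      have : ε ^ 2 ≤ ε := by nlinarith
      gcongr
    linarith
  have hnn : 1000000 ≤ (n : ℝ) := by nlinarith
  obtain ⟨m, hm⟩ : ∃ m, m = ⌈ε * n⌉₊ := ⟨_, rfl⟩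
  have hm1 : ε * n ≤ m := by rw [hm]; exact Nat.le_ceil _
  have hm2 : (m : ℝ) < ε * n + 1 := by rw [hm]; exact Nat.ceil_lt_add_one (by positivity)
  have hmn : m ≤ n := by
    rw [hm]
    refine Nat.ceil_le.2 ?_
    nlinarith
  have hmbig : 1000000 ≤ m := by
    have : (1000000 : ℝ) ≤ m := hεn.trans hm1
    exact_mod_cast this
  obtain ⟨g, hg⟩ : ∃ g, g = Nat.log 6 (m / 5) := ⟨_, rfl⟩
  have hg1 : 5 * 6 ^ g ≤ m := by
    have : 6 ^ g ≤ m / 5 := by rw [hg]; exact Nat.pow_log_le_self 6 (by omega)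
    omega
  have hg2 : m < 5 * 6 ^ (g + 1) := by
    have : m / 5 < 6 ^ (g + 1) := by rw [hg]; exact Nat.lt_pow_succ_log_self (by norm_num) _
    omega
  have hg3 : 3 ≤ g := by
    by_contra h
    have : 6 ^ (g + 1) ≤ 6 ^ 3 := Nat.pow_le_pow_right (by norm_num) (by omega)
    omega
  obtain ⟨K, hK⟩ : ∃ K, K = (n - m) / (2 * m) := ⟨_, rfl⟩
  have hK1 : 2 * m * K ≤ n - m := by rw [hK]; exact Nat.mul_div_le _ _
  have hK2 : n - m < 2 * m * (K + 1) := by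
    rw [hK]; exact Nat.lt_mul_div_succ _ (by omega)
  obtain ⟨X, iX, iF, hcard, hX⟩ := exists_space m g K (n - m - 2 * m * K) hg3 hg1
  refine ⟨X, iX, iF, by omega, ?_⟩
  intro Y _ _ f χ hY hf
  have hlog0 : 0 ≤ Real.logb 2 n := Real.logb_nonneg (by norm_num) (by linarith)
  have hlog : Real.logb 2 n ≤ 6 * (g + 1) := by
    have h1 : (m : ℝ) < 5 * 6 ^ (g + 1) := by exact_mod_cast hg2
    have h2 : (n : ℝ) ≤ 2 ^ (6 * (g + 1)) := by
      have e1 : (2 : ℝ) ^ (6 * (g + 1)) = 64 ^ (g + 1) := by rw [pow_mul]; norm_num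
      have e2 : (36 : ℝ) ^ (g + 1) ≤ 64 ^ (g + 1) := by gcongr; norm_num
      have e3 : (36 : ℝ) ^ (g + 1) = (6 ^ (g + 1)) ^ 2 := by
        rw [← pow_mul, mul_comm, pow_mul]; norm_num
      have e4 : (ε * n) ^ 2 ≤ (5 * 6 ^ (g + 1)) ^ 2 := by
        have : ε * n ≤ 5 * 6 ^ (g + 1) := by linarith
        gcongr
      have e5 : 25 * (n : ℝ) ≤ (ε * n) ^ 2 := by nlinarith
      rw [e1]
      nlinarith
    have h3 := Real.logb_le_logb_of_le (b := 2) (by norm_num) (by linarith) h2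
    rw [Real.logb_pow, Real.logb_self_eq_one (by norm_num)] at h3
    push_cast at h3
    linarith
  have hKε : 1 ≤ 6 * ε * (K + 1) := by
    have h1 : n < 3 * m * (K + 1) := by
      have h0 : n < 2 * m * (K + 1) + m := by omega
      nlinarith
    have h2 : (n : ℝ) < 3 * m * (K + 1) := by exact_mod_cast h1
    have h3 : (m : ℝ) ≤ 2 * (ε * n) := by linarith
    have hK0 : (0 : ℝ) ≤ (K : ℝ) + 1 := by positivity
    have h4 : (n : ℝ) * 1 ≤ n * (6 * ε * (K + 1)) := by nlinarith
    exact le_of_mul_le_mul_left h4 (by linarith)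
  have ht : 3 * (1 / 200 * Real.logb 2 n / ε) < ((K + 1) * (g + 1) : ℕ) := by
    have h1 : Real.logb 2 n / ε ≤ 36 * ((K + 1) * (g + 1)) := by
      rw [div_le_iff₀ hε0]
      have hg0 : (0 : ℝ) ≤ (g : ℝ) + 1 := by positivity
      nlinarith
    have h2 : (0 : ℝ) < ((K : ℝ) + 1) * (g + 1) := by positivity
    push_cast
    rw [mul_div_assoc]
    linarith
  have key := hX Y f χ _ (by positivity) ht hY hf
  have hr : 2 * m * (K + 1) + (n - m - 2 * m * K) = n + m := by
    have : 2 * m * (K + 1) = 2 * m * K + 2 * m := by ring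
    omega
  rw [hr] at key
  have key' : (n : ℝ) + m ≤ ∑ x, ((f x).card : ℝ) := by exact_mod_cast key
  linarith
end
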